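/- arXiv:math/0306276 — 3 statements merged into one kernel-verified Lean document; each statement's English description precedes it below -/
import Mathlib

section
/- Let N ≥ 1 and let w : ℤ → {0,1} be an admissible word with w(k+N) = w(k) for all k ∈ ℤ, and suppose w is not the alternating word, i.e. there exists k with w(k) = w(k+1). Then there exists exactly one point p ∈ ℝ² such that the forward orbit of p is defined up to time N, f^N(p) = p, and f^k(p) ∈ R_{w(k)} for all 0 ≤ k < N. Moreover the least period of p under f (the least m ≥ 1 with f^m(p) = p) equals the least period of w under the shift (the least m ≥ 1 with w(k+m) = w(k) for all k). -/
open Filter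

/-- The birational map f(x,y) = (y(x+a)/(x-1), x+a-1). -/
noncomputable def birat (a : ℝ) (p : ℝ × ℝ) : ℝ × ℝ :=
  (p.2 * (p.1 + a) / (p.1 - 1), p.1 + a - 1)

/-- The inverse map f⁻¹(x,y) = (y+1-a, x(y-a)/(y+1)). -/
noncomputable def biratInv (a : ℝ) (p : ℝ × ℝ) : ℝ × ℝ :=
  (p.2 + 1 - a, p.1 * (p.2 - a) / (p.2 + 1))

/-- The forward orbit of `p` is defined up to time `n`. -/
def orbitDefined (a : ℝ) (p : ℝ × ℝ) (n : ℕ) : Prop :=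
  ∀ k < n, ((birat a)^[k] p).1 ≠ 1

def Rplus : Set (ℝ × ℝ) := {p | p.1 ≤ 1 ∧ p.2 ≤ 0}
def Rminus : Set (ℝ × ℝ) := {p | 0 ≤ p.1 ∧ -1 ≤ p.2}
def Rzero : Set (ℝ × ℝ) := {p | 1 ≤ p.1 ∧ p.2 ≤ -1}
def Rone : Set (ℝ × ℝ) := {p | p.1 ≤ 0 ∧ 0 ≤ p.2}
def intRplus : Set (ℝ × ℝ) := {p | p.1 < 1 ∧ p.2 < 0}
def intRzero : Set (ℝ × ℝ) := {p | 1 < p.1 ∧ p.2 < -1}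
def intRone : Set (ℝ × ℝ) := {p | p.1 < 0 ∧ 0 < p.2}

/-- `Rw 0 = R₀`, `Rw 1 = R₁`. -/
def Rw (i : Fin 2) : Set (ℝ × ℝ) := if i = 0 then Rzero else Rone

/-- `intRw 0 = int R₀`, `intRw 1 = int R₁`. -/
def intRw (i : Fin 2) : Set (ℝ × ℝ) := if i = 0 then intRzero else intRone

/-- Euclidean distance on ℝ². -/
noncomputable def eucDist (p q : ℝ × ℝ) : ℝ :=
  Real.sqrt ((p.1 - q.1) ^ 2 + (p.2 - q.2) ^ 2)

/-! ### The three branches of the recurrence -/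

/-- In the coordinates `ρ > 0` below, the first coordinate of an orbit point whose own symbol is `i`
and whose successor has symbol `j`. -/
noncomputable def branchCoord (c : ℝ) (i j : Fin 2) (r : ℝ) : ℝ :=
  if i = 1 then -r else if j = 1 then c + 1 + r else (1 + c * r) / (1 + r)

/-- The factor by which a coordinate enters the equations of its successors. -/
noncomputable def rightGain (c : ℝ) (i j : Fin 2) (r : ℝ) : ℝ :=
  if i = 1 then c + 1 + r else if j = 1 then (r + 1) / (r + c) else (c + r) / (1 + r)

/-- The factor by which a coordinate enters the equations of its predecessors. -/
noncomputable def leftGain (c : ℝ) (i j : Fin 2) (r : ℝ) : ℝ :=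
  if i = 1 then (r + 1) / (r + c) else if j = 1 then c + 1 + r else (1 + c * r) / (1 + r)

lemma rightGain_pos {c : ℝ} (hc : 1 < c) (i j : Fin 2) {r : ℝ} (hr : 0 < r) :
    0 < rightGain c i j r := by
  unfold rightGain; split_ifs <;> positivity

lemma leftGain_pos {c : ℝ} (hc : 1 < c) (i j : Fin 2) {r : ℝ} (hr : 0 < r) :
    0 < leftGain c i j r := by
  unfold leftGain; split_ifs <;> positivity

lemma continuousOn_rightGain {c : ℝ} (hc : 1 < c) (i j : Fin 2) :
    ContinuousOn (rightGain c i j) (Set.Ioi 0) := by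
  unfold rightGain
  split_ifs
  · fun_prop
  · exact ContinuousOn.div (by fun_prop) (by fun_prop)
      fun r (hr : 0 < r) => by positivity
  · exact ContinuousOn.div (by fun_prop) (by fun_prop)
      fun r (hr : 0 < r) => by positivity

lemma continuousOn_leftGain {c : ℝ} (hc : 1 < c) (i j : Fin 2) :
    ContinuousOn (leftGain c i j) (Set.Ioi 0) := by
  unfold leftGain
  split_ifs
  · exact ContinuousOn.div (by fun_prop) (by fun_prop)
      fun r (hr : 0 < r) => by positivity
  · fun_prop
  · exact ContinuousOn.div (by fun_prop) (by fun_prop)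
      fun r (hr : 0 < r) => by positivity

lemma abs_log_add_lt_of_le {p p' q q' r r' : ℝ} (hp : 0 < p) (hp' : 0 < p') (hq : 0 < q)
    (hq' : 0 < q') (hr : 0 < r) (hr' : 0 < r') (hrr : r < r') (h1 : p ≤ p') (h2 : q ≤ q')
    (h : p' * q' * r < p * q * r') :
    |Real.log p - Real.log p'| + |Real.log q - Real.log q'| < |Real.log r - Real.log r'| := by
  have e1 := Real.log_le_log hp h1
  have e2 := Real.log_le_log hq h2
  have e3 := Real.log_lt_log hr hrr
  have e4 := Real.log_lt_log (by positivity) h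
  rw [Real.log_mul (by positivity) (by positivity), Real.log_mul (by positivity) (by positivity),
    Real.log_mul (by positivity) (by positivity),
    Real.log_mul (by positivity) (by positivity)] at e4
  rw [abs_of_nonpos (by linarith), abs_of_nonpos (by linarith), abs_of_nonpos (by linarith)]
  linarith

lemma gain_contract_of_lt {c : ℝ} (hc : 1 < c) (i j : Fin 2) {r r' : ℝ} (hr : 0 < r)
    (hrr : r < r') :
    |Real.log (rightGain c i j r) - Real.log (rightGain c i j r')| +
      |Real.log (leftGain c i j r) - Real.log (leftGain c i j r')| <
      |Real.log r - Real.log r'| := by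
  have hr' : 0 < r' := hr.trans hrr
  have hg : (r + 1) / (r + c) ≤ (r' + 1) / (r' + c) := by
    rw [div_le_div_iff₀ (by positivity) (by positivity)]; nlinarith
  have key : (c + 1 + r') * ((r' + 1) / (r' + c)) * r < (c + 1 + r) * ((r + 1) / (r + c)) * r' := by
    have e : ∀ s t : ℝ, (c + 1 + s) * ((s + 1) / (s + c)) * t
        = ((c + 1 + s) * (s + 1) * t) / (s + c) := fun s t => by ring
    rw [e, e, div_lt_div_iff₀ (by positivity) (by positivity)]
    have h1 : 0 < r * r' := by positivity
    have h2 : 0 < r' - r := by linarith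
    have h3 : 0 < (r' - r) * (2 * (r * r') + (c + 1) * (r + r') + c * (c + 1)) := by positivity
    nlinarith
  unfold rightGain leftGain
  split_ifs
  · exact abs_log_add_lt_of_le (by positivity) (by positivity) (by positivity) (by positivity)
      hr hr' hrr (by linarith) hg key
  · exact abs_log_add_lt_of_le (by positivity) (by positivity) (by positivity) (by positivity)
      hr hr' hrr hg (by linarith) (by linarith)
  · have e : ∀ s : ℝ, 0 < s → Real.log ((c + s) / (1 + s)) = - Real.log ((1 + s) / (c + s)) :=
      fun s hs => by rw [← Real.log_inv, inv_div]
    rw [e r hr, e r' hr', neg_sub_neg, abs_sub_comm]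
    refine abs_log_add_lt_of_le (by positivity) (by positivity) (by positivity) (by positivity)
      hr hr' hrr ?_ ?_ ?_
    · rw [div_le_div_iff₀ (by positivity) (by positivity)]; nlinarith
    · rw [div_le_div_iff₀ (by positivity) (by positivity)]; nlinarith
    · have e : ∀ s t : ℝ, 0 < s → (1 + s) / (c + s) * ((1 + c * s) / (1 + s)) * t
        = ((1 + c * s) * t) / (c + s) := fun s t hs => by field_simp
      rw [e _ _ hr, e _ _ hr', div_lt_div_iff₀ (by positivity) (by positivity)]
      have h1 : 0 < (r' - r) * (c + (r + r') + c * (r * r')) :=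
        mul_pos (by linarith) (by positivity)
      nlinarith

lemma gain_contract {c : ℝ} (hc : 1 < c) (i j : Fin 2) {r r' : ℝ} (hr : 0 < r) (hr' : 0 < r')
    (hne : r ≠ r') :
    |Real.log (rightGain c i j r) - Real.log (rightGain c i j r')| +
      |Real.log (leftGain c i j r) - Real.log (leftGain c i j r')| <
      |Real.log r - Real.log r'| := by
  rcases lt_or_gt_of_ne hne with h | h
  · exact gain_contract_of_lt hc i j hr h
  · have := gain_contract_of_lt hc i j hr' h
    simpa only [abs_sub_comm] using this

lemma gain_nonexpansive {c : ℝ} (hc : 1 < c) (i j : Fin 2) {r r' : ℝ} (hr : 0 < r) (hr' : 0 < r') :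
    |Real.log (rightGain c i j r) - Real.log (rightGain c i j r')| +
      |Real.log (leftGain c i j r) - Real.log (leftGain c i j r')| ≤
      |Real.log r - Real.log r'| := by
  by_cases h : r = r'
  · simp [h]
  · exact (gain_contract hc i j hr hr' h).le

lemma fin_two_eq_one {i : Fin 2} (h : i ≠ 0) : i = 1 := by omega

/-! ### The cyclic transfer operator -/

section Cyclic

variable {N : ℕ}

/-- Solving the equations of a cyclic orbit with itinerary `W` for the dominant variables. -/
noncomputable def transfer (c : ℝ) (W : ZMod N → Fin 2) (r : ZMod N → ℝ) (k : ZMod N) : ℝ :=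
  let R := fun j => rightGain c (W j) (W (j + 1)) (r j)
  let L := fun j => leftGain c (W j) (W (j + 1)) (r j)
  if W k = 1 then R (k - 1) * R (k - 1 - 1)
  else if W (k + 1) = 1 then L (k + 1) * L (k + 1 + 1)
  else R (k - 1) / L (k + 1)

/-- The logarithmic `ℓ¹` distance. -/
noncomputable def logDist [NeZero N] (r r' : ZMod N → ℝ) : ℝ :=
  ∑ k, |Real.log (r k) - Real.log (r' k)|

lemma transfer_pos {c : ℝ} (hc : 1 < c) (W : ZMod N → Fin 2) {r : ZMod N → ℝ}
    (hr : ∀ k, 0 < r k) (k : ZMod N) : 0 < transfer c W r k := by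
  have hR := fun j => rightGain_pos hc (W j) (W (j + 1)) (hr j)
  have hL := fun j => leftGain_pos hc (W j) (W (j + 1)) (hr j)
  simp only [transfer]
  split_ifs
  · exact mul_pos (hR _) (hR _)
  · exact mul_pos (hL _) (hL _)
  · exact div_pos (hR _) (hL _)

lemma transfer_contract [NeZero N] {c : ℝ} (hc : 1 < c) {W : ZMod N → Fin 2}
    (hW : ∀ k, ¬(W k = 1 ∧ W (k + 1) = 1)) {r r' : ZMod N → ℝ}
    (hr : ∀ k, 0 < r k) (hr' : ∀ k, 0 < r' k) (hne : r ≠ r') :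
    logDist (transfer c W r) (transfer c W r') < logDist r r' := by
  set R := fun j => |Real.log (rightGain c (W j) (W (j + 1)) (r j)) -
    Real.log (rightGain c (W j) (W (j + 1)) (r' j))| with hRdef
  set L := fun j => |Real.log (leftGain c (W j) (W (j + 1)) (r j)) -
    Real.log (leftGain c (W j) (W (j + 1)) (r' j))| with hLdef
  set e := fun k => if W (k + 1) = 1 then L (k + 1 + 1) - R (k - 1) else 0 with he
  have hR := fun j => (rightGain_pos hc (W j) (W (j + 1)) (hr j)).ne'
  have hL := fun j => (leftGain_pos hc (W j) (W (j + 1)) (hr j)).ne'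
  have hR' := fun j => (rightGain_pos hc (W j) (W (j + 1)) (hr' j)).ne'
  have hL' := fun j => (leftGain_pos hc (W j) (W (j + 1)) (hr' j)).ne'
  have hk : ∀ k, |Real.log (transfer c W r k) - Real.log (transfer c W r' k)| ≤
      R (k - 1) + L (k + 1) + e k - e (k - 1) := by
    intro k
    by_cases h1 : W k = 1
    · have h2 : W (k + 1) ≠ 1 := fun h => hW k ⟨h1, h⟩
      have : R (k - 1) + L (k + 1) + e k - e (k - 1) = R (k - 1) + R (k - 1 - 1) := by
        simp only [he, sub_add_cancel, h1, h2, if_true, if_false]; ring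
      rw [this]
      simp only [transfer, h1, if_true]
      rw [Real.log_mul (hR _) (hR _), Real.log_mul (hR' _) (hR' _), add_sub_add_comm]
      exact abs_add_le _ _
    · by_cases h2 : W (k + 1) = 1
      · have : R (k - 1) + L (k + 1) + e k - e (k - 1) = L (k + 1) + L (k + 1 + 1) := by
          simp only [he, sub_add_cancel, h1, h2, if_true, if_false]; ring
        rw [this]
        simp only [transfer, if_neg h1, if_pos h2]
        rw [Real.log_mul (hL _) (hL _), Real.log_mul (hL' _) (hL' _), add_sub_add_comm]
        exact abs_add_le _ _
      · have : R (k - 1) + L (k + 1) + e k - e (k - 1) = R (k - 1) + L (k + 1) := by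
          simp only [he, sub_add_cancel, h1, h2, if_false]; ring
        rw [this]
        simp only [transfer, if_neg h1, if_neg h2]
        rw [Real.log_div (hR _) (hL _), Real.log_div (hR' _) (hL' _), sub_sub_sub_comm]
        exact abs_sub _ _
  have shiftSub : ∀ g : ZMod N → ℝ, ∑ k, g (k - 1) = ∑ k, g k := fun g =>
    Equiv.sum_comp (Equiv.subRight (1 : ZMod N)) g
  have shiftAdd : ∀ g : ZMod N → ℝ, ∑ k, g (k + 1) = ∑ k, g k := fun g =>
    Equiv.sum_comp (Equiv.addRight (1 : ZMod N)) g
  obtain ⟨j, hj⟩ := Function.ne_iff.mp hne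
  calc logDist (transfer c W r) (transfer c W r')
      ≤ ∑ k, (R (k - 1) + L (k + 1) + e k - e (k - 1)) := Finset.sum_le_sum fun k _ => hk k
    _ = ∑ k, (R k + L k) := by
        rw [Finset.sum_sub_distrib, Finset.sum_add_distrib, Finset.sum_add_distrib, shiftSub e,
          shiftSub R, shiftAdd L, Finset.sum_add_distrib]
        ring
    _ < logDist r r' := Finset.sum_lt_sum
        (fun k _ => gain_nonexpansive hc _ _ (hr k) (hr' k))
        ⟨j, Finset.mem_univ j, gain_contract hc _ _ (hr j) (hr' j) hj⟩

lemma transfer_fixed_unique [NeZero N] {c : ℝ} (hc : 1 < c) {W : ZMod N → Fin 2}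
    (hW : ∀ k, ¬(W k = 1 ∧ W (k + 1) = 1)) {r r' : ZMod N → ℝ}
    (hr : ∀ k, 0 < r k) (hr' : ∀ k, 0 < r' k) (h : transfer c W r = r)
    (h' : transfer c W r' = r') : r = r' := by
  by_contra hne
  have := transfer_contract hc hW hr hr' hne
  rw [h, h'] at this
  exact lt_irrefl _ this

/-- Upper bound for the coordinates in an invariant box. -/
noncomputable def boxBound (c : ℝ) (W : ZMod N → Fin 2) (j k : ZMod N) : ℝ :=
  if W k = 1 then (c + 1) * ((k - j).val + 1)
  else if W (k + 1) = 1 then (c + 1) * ((j - k).val + 1)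
  else (c + 1) * (N + 1)

lemma boxBound_le [NeZero N] {c : ℝ} (hc : 1 < c) (W : ZMod N → Fin 2) (j k : ZMod N) :
    boxBound c W j k ≤ (c + 1) * (N + 1) := by
  have h : ∀ i : ZMod N, ((i.val : ℝ)) ≤ N := fun i => by
    exact_mod_cast (ZMod.val_lt i).le
  have h1 := h (k - j)
  have h2 := h (j - k)
  unfold boxBound
  split_ifs <;> nlinarith

lemma one_le_boxBound {c : ℝ} (hc : 1 < c) (W : ZMod N → Fin 2) (j k : ZMod N) :
    1 ≤ boxBound c W j k := by
  have h : ∀ i : ℕ, 1 ≤ (c + 1) * ((i : ℝ) + 1) := fun i => by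
    have : (0 : ℝ) ≤ i := Nat.cast_nonneg i
    nlinarith
  unfold boxBound
  split_ifs <;> exact h _

lemma val_sub_one_sub_one [NeZero N] {i : ZMod N} (h0 : i ≠ 0) (h1 : i ≠ 1) :
    (i - 1 - 1).val + 2 = i.val := by
  obtain ⟨n, hn, rfl⟩ : ∃ n, n < N ∧ ((n : ℕ) : ZMod N) = i :=
    ⟨i.val, ZMod.val_lt i, ZMod.natCast_zmod_val i⟩
  obtain _ | _ | n := n
  · simp at h0
  · simp at h1
  · have e : ((n + 1 + 1 : ℕ) : ZMod N) - 1 - 1 = (n : ZMod N) := by push_cast; ring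
    rw [e, ZMod.val_natCast_of_lt hn, ZMod.val_natCast_of_lt (by omega)]

lemma add_one_div_add_bounds {c r : ℝ} (hc : 1 < c) (hr : 0 < r) :
    1 / c ≤ (r + 1) / (r + c) ∧ (r + 1) / (r + c) ≤ 1 := by
  constructor
  · rw [div_le_div_iff₀ (by positivity) (by positivity)]; nlinarith
  · rw [div_le_one (by positivity)]; linarith

lemma transfer_mem_box [NeZero N] {c : ℝ} (hc : 1 < c) {W : ZMod N → Fin 2}
    (hW : ∀ k, ¬(W k = 1 ∧ W (k + 1) = 1)) {j : ZMod N} (hj : W j = 0) (hj' : W (j + 1) = 0)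
    {r : ZMod N → ℝ} (hr : ∀ k, 0 < r k) (hb : ∀ k, r k ≤ boxBound c W j k) (k : ZMod N) :
    1 / ((c + 1) * (N + 1)) ≤ transfer c W r k ∧ transfer c W r k ≤ boxBound c W j k := by
  have hN : (1 : ℝ) ≤ N := by exact_mod_cast NeZero.one_le
  have hM : 0 < (c + 1) * ((N : ℝ) + 1) := by positivity
  have hMc : 1 / ((c + 1) * ((N : ℝ) + 1)) ≤ 1 / c := one_div_le_one_div_of_le (by positivity)
    (by nlinarith)
  have hA : ∀ s : ℝ, 0 < s → 1 ≤ (c + s) / (1 + s) ∧ (c + s) / (1 + s) ≤ c := fun s hs => by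
    constructor
    · rw [one_le_div (by positivity)]; linarith
    · rw [div_le_iff₀ (by positivity)]; nlinarith
  have hA' : ∀ s : ℝ, 0 < s → 1 ≤ (1 + c * s) / (1 + s) ∧ (1 + c * s) / (1 + s) ≤ c :=
    fun s hs => by
    constructor
    · rw [one_le_div (by positivity)]; nlinarith
    · rw [div_le_iff₀ (by positivity)]; nlinarith
  have hval : ∀ i : ZMod N, (0 : ℝ) ≤ i.val := fun i => Nat.cast_nonneg _
  have hvalN : ∀ i : ZMod N, (i.val : ℝ) + 1 ≤ N := fun i => by exact_mod_cast ZMod.val_lt i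
  have hone : ∀ i, W (i + 1) = 1 → W i ≠ 1 := fun i h h' => hW i ⟨h', h⟩
  have hR : ∀ i, W (i + 1) ≠ 1 → 1 ≤ rightGain c (W i) (W (i + 1)) (r i) ∧
      rightGain c (W i) (W (i + 1)) (r i) ≤
        if W i = 1 then (c + 1) * ((i - j).val + 2) else c := fun i hi => by
    unfold rightGain
    have h1 := hb i
    unfold boxBound at h1
    split_ifs at h1 ⊢ with h
    · constructor <;> linarith [hr i]
    · exact hA _ (hr i)
  have hL : ∀ i, W i ≠ 1 → 1 ≤ leftGain c (W i) (W (i + 1)) (r i) ∧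
      leftGain c (W i) (W (i + 1)) (r i) ≤
        if W (i + 1) = 1 then (c + 1) * ((j - i).val + 2) else c := fun i hi => by
    unfold leftGain
    have h1 := hb i
    unfold boxBound at h1
    simp only [if_neg hi] at h1 ⊢
    split_ifs at h1 ⊢ with h
    · constructor <;> linarith [hr i]
    · exact hA' _ (hr i)
  have prod : ∀ {p q B : ℝ}, 1 / c ≤ p → p ≤ 1 → 1 ≤ q → q ≤ B →
      1 / ((c + 1) * ((N : ℝ) + 1)) ≤ p * q ∧ p * q ≤ B := fun {p q B} h1 h2 h3 h4 => by
    have h0 : 0 < 1 / c := by positivity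
    constructor <;> nlinarith
  by_cases h1 : W k = 1
  · have e0 : W (k - 1) ≠ 1 := hone _ (by simpa using h1)
    have e1 : W (k - 1 - 1 + 1) ≠ 1 := by simpa using e0
    have hR2 := hR (k - 1 - 1) e1
    have hg : rightGain c (W (k - 1)) (W (k - 1 + 1)) (r (k - 1)) =
        (r (k - 1) + 1) / (r (k - 1) + c) := by
      simp [rightGain, e0, h1]
    have hgb := add_one_div_add_bounds hc (hr (k - 1))
    simp only [transfer, boxBound, if_pos h1]
    rw [hg]
    refine prod hgb.1 hgb.2 hR2.1 (hR2.2.trans ?_)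
    split_ifs with h
    · have := val_sub_one_sub_one (i := k - j)
        (fun h => by rw [sub_eq_zero.mp h, hj] at h1; simp at h1)
        (fun h => by rw [sub_eq_iff_eq_add'.mp h, hj'] at h1; simp at h1)
      have e : k - 1 - 1 - j = k - j - 1 - 1 := by ring
      rw [e, ← this]
      push_cast
      nlinarith
    · nlinarith [hval (k - j)]
  · by_cases h2 : W (k + 1) = 1
    · have e1 : W (k + 1 + 1) ≠ 1 := fun h => hW _ ⟨h2, h⟩
      have hL2 := hL (k + 1 + 1) e1
      have hg : leftGain c (W (k + 1)) (W (k + 1 + 1)) (r (k + 1)) =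
          (r (k + 1) + 1) / (r (k + 1) + c) := by
        simp [leftGain, h2]
      have hgb := add_one_div_add_bounds hc (hr (k + 1))
      simp only [transfer, boxBound, if_neg h1, if_pos h2]
      rw [hg]
      refine prod hgb.1 hgb.2 hL2.1 (hL2.2.trans ?_)
      split_ifs with h
      · have := val_sub_one_sub_one (i := j - k)
          (fun h => by rw [← sub_eq_zero.mp h, hj'] at h2; simp at h2)
          (fun h => by rw [add_comm k 1, ← sub_eq_iff_eq_add.mp h, hj] at h2; simp at h2)
        have e : j - (k + 1 + 1) = j - k - 1 - 1 := by ring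
        rw [e, ← this]
        push_cast
        nlinarith
      · nlinarith [hval (j - k)]
    · have hR2 := hR (k - 1) (by simpa using h1)
      have hL2 := hL (k + 1) h2
      have hRM : rightGain c (W (k - 1)) (W (k - 1 + 1)) (r (k - 1)) ≤ (c + 1) * (N + 1) := by
        refine hR2.2.trans ?_
        split_ifs <;> nlinarith [hvalN (k - 1 - j)]
      have hLM : leftGain c (W (k + 1)) (W (k + 1 + 1)) (r (k + 1)) ≤ (c + 1) * (N + 1) := by
        refine hL2.2.trans ?_
        split_ifs <;> nlinarith [hvalN (j - (k + 1))]
      simp only [transfer, boxBound, if_neg h1, if_neg h2]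
      exact ⟨div_le_div₀ (by linarith) hR2.1 (by linarith) hLM,
        (div_le_self (by linarith) hL2.1).trans hRM⟩

lemma continuousOn_transfer {c : ℝ} (hc : 1 < c) (W : ZMod N → Fin 2) {s : Set (ZMod N → ℝ)}
    (hs : ∀ r ∈ s, ∀ k, 0 < r k) (k : ZMod N) : ContinuousOn (fun r => transfer c W r k) s := by
  have hR : ∀ j, ContinuousOn
      (fun r : ZMod N → ℝ => rightGain c (W j) (W (j + 1)) (r j)) s := fun j =>
    (continuousOn_rightGain hc _ _).comp (continuous_apply j).continuousOn fun r hr => hs r hr j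
  have hL : ∀ j, ContinuousOn
      (fun r : ZMod N → ℝ => leftGain c (W j) (W (j + 1)) (r j)) s := fun j =>
    (continuousOn_leftGain hc _ _).comp (continuous_apply j).continuousOn fun r hr => hs r hr j
  simp only [transfer]
  split_ifs
  · exact (hR _).mul (hR _)
  · exact (hL _).mul (hL _)
  · exact (hR _).div (hL _) fun r hr => (leftGain_pos hc _ _ (hs r hr _)).ne'

lemma exists_transfer_fixed [NeZero N] {c : ℝ} (hc : 1 < c) {W : ZMod N → Fin 2}
    (hW : ∀ k, ¬(W k = 1 ∧ W (k + 1) = 1)) {j : ZMod N} (hj : W j = 0) (hj' : W (j + 1) = 0) :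
    ∃ r : ZMod N → ℝ, (∀ k, 0 < r k) ∧ transfer c W r = r := by
  have hN : (1 : ℝ) ≤ N := by exact_mod_cast NeZero.one_le
  have hM : 0 < 1 / ((c + 1) * ((N : ℝ) + 1)) := by positivity
  set s : Set (ZMod N → ℝ) := Set.univ.pi fun k =>
    Set.Icc (1 / ((c + 1) * ((N : ℝ) + 1))) (boxBound c W j k) with hsdef
  have hs : ∀ r ∈ s, ∀ k, 0 < r k := fun r hr k => hM.trans_le (hr k (Set.mem_univ k)).1
  have hT : ∀ r ∈ s, transfer c W r ∈ s := fun r hr k _ =>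
    transfer_mem_box hc hW hj hj' (hs r hr) (fun i => (hr i (Set.mem_univ i)).2) k
  have hne : s.Nonempty := ⟨fun _ => 1, fun k _ =>
    ⟨by rw [div_le_one (by positivity)]; nlinarith, one_le_boxBound hc W j k⟩⟩
  have hcont : ContinuousOn (fun r => logDist r (transfer c W r)) s := by
    unfold logDist
    refine continuousOn_finsetSum _ fun k _ => ContinuousOn.abs (ContinuousOn.sub ?_ ?_)
    · exact (continuous_apply k).continuousOn.log fun r hr => (hs r hr k).ne'
    · exact (continuousOn_transfer hc W hs k).log fun r hr => (transfer_pos hc W (hs r hr) k).ne'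
  obtain ⟨r, hr, hmin⟩ := (isCompact_univ_pi fun k => isCompact_Icc).exists_isMinOn hne hcont
  refine ⟨r, hs r hr, ?_⟩
  by_contra hfix
  have h1 := transfer_contract hc hW (hs r hr) (hs _ (hT r hr)) (Ne.symm hfix)
  exact absurd (hmin (hT r hr)) (not_le.mpr h1)

/-! ### Cyclic orbits of the second-order recurrence -/

/-- First coordinates of a cyclic orbit of `birat (-c)` with itinerary `W`. -/
def IsCyclicOrbit (c : ℝ) (W : ZMod N → Fin 2) (x : ZMod N → ℝ) : Prop :=
  ∀ k, (W k = 0 → 1 ≤ x k ∧ x (k - 1) ≤ c) ∧ (W k = 1 → x k ≤ 0 ∧ c + 1 ≤ x (k - 1)) ∧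
    x (k + 1) * (x k - 1) = (x k - c) * (x (k - 1) - c - 1)

lemma rightGain_eq (c : ℝ) (i : Fin 2) {j : Fin 2} (hj : j ≠ 1) {r : ℝ} (hr : 0 < r) :
    rightGain c i j r = c + 1 - branchCoord c i j r := by
  unfold rightGain branchCoord
  split_ifs
  · ring
  · field_simp; ring

lemma leftGain_eq (c : ℝ) {i : Fin 2} (hi : i ≠ 1) (j : Fin 2) (r : ℝ) :
    leftGain c i j r = branchCoord c i j r := by
  simp only [leftGain, branchCoord, if_neg hi]

lemma isCyclicOrbit_of_transfer_fixed {c : ℝ} (hc : 1 < c) {W : ZMod N → Fin 2}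
    (hW : ∀ k, ¬(W k = 1 ∧ W (k + 1) = 1)) {r : ZMod N → ℝ}
    (hr : ∀ k, 0 < r k) (h : transfer c W r = r) :
    IsCyclicOrbit c W fun k => branchCoord c (W k) (W (k + 1)) (r k) := by
  have hone : ∀ i, W (i + 1) = 1 → W i ≠ 1 := fun i h h' => hW i ⟨h', h⟩
  intro k
  have hrk := hr k
  refine ⟨fun h0 => ⟨?_, ?_⟩, fun h1 => ⟨?_, ?_⟩, ?_⟩
  · simp only [branchCoord, h0]
    split_ifs with h1 h2
    · simp at h1
    · linarith
    · rw [one_le_div (by positivity)]; nlinarith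
  · have := hr (k - 1)
    simp only [branchCoord, sub_add_cancel, h0]
    split_ifs with h1 h2
    · linarith
    · simp at h2
    · rw [div_le_iff₀ (by positivity)]; nlinarith
  · simp only [branchCoord, h1, if_true]; linarith
  · have h0 : W (k - 1) ≠ 1 := hone _ (by simpa using h1)
    simp only [branchCoord, sub_add_cancel, h1, h0, if_true, if_false]
    linarith [hr (k - 1)]
  · by_cases h1 : W k = 1
    · have h0 : W (k - 1) ≠ 1 := hone _ (by simpa using h1)
      have h2 : W (k + 1) ≠ 1 := fun h => hW k ⟨h1, h⟩
      have e := congrFun h (k - 1)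
      simp only [transfer, sub_add_cancel, h0, h1, if_true, if_false] at e
      rw [leftGain_eq c h2] at e
      simp only [leftGain, if_true] at e
      simp only [sub_add_cancel, h1]
      have e1 : branchCoord c 1 (W (k + 1)) (r k) = - r k := by simp [branchCoord]
      have e2 : branchCoord c (W (k - 1)) 1 (r (k - 1)) = c + 1 + r (k - 1) := by
        simp [branchCoord, h0]
      rw [e1, e2, ← e]
      field_simp
      ring
    · by_cases h2 : W (k + 1) = 1
      · have e := congrFun h (k + 1)
        simp only [transfer, add_sub_cancel_right, h2, sub_add_cancel, if_true] at e
        rw [rightGain_eq c _ h1 (hr _)] at e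
        simp only [rightGain, if_true, h1, if_false] at e
        simp only [sub_add_cancel, h2]
        have e1 : branchCoord c 1 (W (k + 1 + 1)) (r (k + 1)) = - r (k + 1) := by
          simp [branchCoord]
        have e2 : branchCoord c (W k) 1 (r k) = c + 1 + r k := by
          simp [branchCoord, h1]
        rw [e1, e2, ← e]
        field_simp
        ring
      · have e := congrFun h k
        simp only [transfer, h1, h2, if_false] at e
        have hp := leftGain_pos hc (W (k + 1)) (W (k + 1 + 1)) (hr (k + 1))
        rw [rightGain_eq c _ (by simpa using h1) (hr _), leftGain_eq c h2] at e
        rw [leftGain_eq c h2] at hp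
        rw [div_eq_iff hp.ne'] at e
        have e2 : branchCoord c (W k) (W (k + 1)) (r k) = (1 + c * r k) / (1 + r k) := by
          simp [branchCoord, h1, h2]
        have e3 : branchCoord c (W (k - 1)) (W (k - 1 + 1)) (r (k - 1)) =
            c + 1 - r k * branchCoord c (W (k + 1)) (W (k + 1 + 1)) (r (k + 1)) := by
          linarith
        simp only [e2, e3]
        field_simp
        ring

/-- The positive coordinate of a point on a cyclic orbit. -/
noncomputable def branchParam (c : ℝ) (i j : Fin 2) (x : ℝ) : ℝ :=
  if i = 1 then -x else if j = 1 then x - (c + 1) else (x - 1) / (c - x)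

lemma IsCyclicOrbit.branchParam_pos {c : ℝ} (hc : 1 < c) {W : ZMod N → Fin 2}
    (hW : ∀ k, ¬(W k = 1 ∧ W (k + 1) = 1)) {x : ZMod N → ℝ} (hx : IsCyclicOrbit c W x)
    (k : ZMod N) : 0 < branchParam c (W k) (W (k + 1)) (x k) := by
  have hone : ∀ i, W (i + 1) = 1 → W i ≠ 1 := fun i h h' => hW i ⟨h', h⟩
  have hzero : ∀ i : Fin 2, i ≠ 1 → i = 0 := fun i hi => by omega
  unfold branchParam
  split_ifs with h1 h2
  · have h0 := hzero _ (hone (k - 1) (by simpa using h1))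
    have a1 := (hx k).2.1 h1
    have a2 := (hx (k - 1)).1 h0
    have a3 := (hx (k - 1)).2.2
    rw [sub_add_cancel] at a3
    by_contra hcon
    have : x k = 0 := by linarith
    rw [this, zero_mul] at a3
    have := mul_ne_zero (a := x (k - 1) - c) (b := x (k - 1 - 1) - c - 1) (by linarith)
      (by linarith)
    exact this a3.symm
  · have h3 := hzero _ fun h => hW _ ⟨h2, h⟩
    have a1 := (hx (k + 1)).2.1 h2
    have a2 := (hx (k + 1 + 1)).1 h3
    have a3 := (hx (k + 1)).2.2
    rw [add_sub_cancel_right] at a1 a2 a3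
    by_contra hcon
    have e : x k - c - 1 = 0 := by linarith
    rw [e, mul_zero] at a3
    exact mul_ne_zero (by linarith) (by linarith) a3
  · have a1 := (hx k).1 (hzero _ h1)
    have a2 := (hx (k + 1)).1 (hzero _ h2)
    have a3 := (hx k).2.2
    rw [add_sub_cancel_right] at a2
    apply div_pos
    · refine lt_of_le_of_ne (by linarith) fun e => ?_
      rw [← e, mul_zero] at a3
      exact mul_ne_zero (by linarith) (by linarith) a3.symm
    · refine lt_of_le_of_ne (by linarith) fun e => ?_
      have e' : x k - c = 0 := by linarith
      rw [e', zero_mul] at a3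
      exact mul_ne_zero (by linarith) (by linarith) a3

lemma IsCyclicOrbit.branchCoord_branchParam {c : ℝ} (hc : 1 < c) {W : ZMod N → Fin 2}
    (hW : ∀ k, ¬(W k = 1 ∧ W (k + 1) = 1)) {x : ZMod N → ℝ} (hx : IsCyclicOrbit c W x)
    (k : ZMod N) : branchCoord c (W k) (W (k + 1))
      (branchParam c (W k) (W (k + 1)) (x k)) = x k := by
  have hpos := hx.branchParam_pos hc hW k
  unfold branchParam at hpos
  unfold branchCoord branchParam
  split_ifs at hpos ⊢ with h1 h2
  · ring
  · ring
  · have : c - x k ≠ 0 := fun h => by simp [h] at hpos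
    have h2 : c - x k + (x k - 1) ≠ 0 := by
      have : c - x k + (x k - 1) = c - 1 := by ring
      rw [this]; linarith
    field_simp
    ring

lemma IsCyclicOrbit.transfer_fixed {c : ℝ} (hc : 1 < c) {W : ZMod N → Fin 2}
    (hW : ∀ k, ¬(W k = 1 ∧ W (k + 1) = 1)) {x : ZMod N → ℝ} (hx : IsCyclicOrbit c W x) :
    transfer c W (fun k => branchParam c (W k) (W (k + 1)) (x k)) =
      fun k => branchParam c (W k) (W (k + 1)) (x k) := by
  have hone : ∀ i, W (i + 1) = 1 → W i ≠ 1 := fun i h h' => hW i ⟨h', h⟩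
  have hpos := hx.branchParam_pos hc hW
  have hco := hx.branchCoord_branchParam hc hW
  have hR : ∀ i, W (i + 1) ≠ 1 → rightGain c (W i) (W (i + 1))
      (branchParam c (W i) (W (i + 1)) (x i)) = c + 1 - x i := fun i hi => by
    rw [rightGain_eq c _ hi (hpos i), hco]
  have hL : ∀ i, W i ≠ 1 → leftGain c (W i) (W (i + 1))
      (branchParam c (W i) (W (i + 1)) (x i)) = x i := fun i hi => by
    rw [leftGain_eq c hi, hco]
  funext k
  by_cases h1 : W k = 1
  · have h0 : W (k - 1) ≠ 1 := hone _ (by simpa using h1)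
    have a3 := (hx (k - 1)).2.2
    have hp := hpos (k - 1)
    simp only [transfer]
    rw [hR (k - 1 - 1) (by simpa using h0)]
    simp only [sub_add_cancel, h0, h1, if_true, rightGain, branchParam, if_false] at a3 hp ⊢
    rw [div_mul_eq_mul_div, div_eq_iff (by linarith)]
    linarith
  · by_cases h2 : W (k + 1) = 1
    · have h3 : W (k + 1 + 1) ≠ 1 := fun h => hW _ ⟨h2, h⟩
      have a3 := (hx (k + 1)).2.2
      have hp := hpos (k + 1)
      simp only [transfer]
      rw [hL (k + 1 + 1) h3]
      simp only [add_sub_cancel_right, h1, h2, if_true, leftGain, branchParam, if_false]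
        at a3 hp ⊢
      rw [div_mul_eq_mul_div, div_eq_iff (by linarith)]
      linarith
    · have a3 := (hx k).2.2
      have hp := hpos k
      have hp1 := leftGain_pos hc (W (k + 1)) (W (k + 1 + 1)) (hpos (k + 1))
      simp only [transfer]
      rw [hL (k + 1) h2] at hp1 ⊢
      rw [hR (k - 1) (by simpa using h1)]
      simp only [h1, h2, branchParam, if_false] at hp ⊢
      have : c - x k ≠ 0 := fun h => by simp [h] at hp
      rw [div_eq_div_iff hp1.ne' this]
      linarith

lemma existsUnique_isCyclicOrbit [NeZero N] {c : ℝ} (hc : 1 < c) {W : ZMod N → Fin 2}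
    (hW : ∀ k, ¬(W k = 1 ∧ W (k + 1) = 1)) {j : ZMod N} (hj : W j = 0) (hj' : W (j + 1) = 0) :
    ∃! x, IsCyclicOrbit c W x := by
  obtain ⟨r, hr, hfix⟩ := exists_transfer_fixed hc hW hj hj'
  have hx := isCyclicOrbit_of_transfer_fixed hc hW hr hfix
  refine ⟨_, hx, fun y hy => ?_⟩
  have e := transfer_fixed_unique hc hW (hy.branchParam_pos hc hW) hr
    (hy.transfer_fixed hc hW) hfix
  funext k
  rw [← hy.branchCoord_branchParam hc hW k, ← congrFun e k]

end Cyclic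

/-! ### Periodic points of the birational map -/

/-- The points described by an `N`-periodic itinerary. -/
def HasItinerary (a : ℝ) (N : ℕ) (w : ℤ → Fin 2) (p : ℝ × ℝ) : Prop :=
  orbitDefined a p N ∧ (birat a)^[N] p = p ∧ ∀ k : ℕ, k < N → (birat a)^[k] p ∈ Rw (w (k : ℤ))

lemma HasItinerary.iterate {a : ℝ} {N : ℕ} {w : ℤ → Fin 2} {p : ℝ × ℝ}
    (h : HasItinerary a N w p) (hN : 1 ≤ N) (hper : ∀ k : ℤ, w (k + (N : ℤ)) = w k) (k : ℕ) :
    ((birat a)^[k] p).1 ≠ 1 ∧ (birat a)^[k] p ∈ Rw (w (k : ℤ)) := by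
  induction k using Nat.strong_induction_on with
  | _ k ih =>
    by_cases hk : k < N
    · exact ⟨h.1 k hk, h.2.2 k hk⟩
    · obtain ⟨m, rfl⟩ := Nat.exists_eq_add_of_le (not_lt.mp hk)
      have := ih m (by omega)
      rw [add_comm N m, Function.iterate_add_apply, h.2.1]
      push_cast
      rw [hper]
      exact this

lemma periodic_word_mod {N : ℕ} {w : ℤ → Fin 2} (hper : ∀ k : ℤ, w (k + (N : ℤ)) = w k)
    {k l : ℤ} (h : (k : ZMod N) = l) : w k = w l := by
  have hp : Function.Periodic w (N : ℤ) := hper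
  obtain ⟨d, hd⟩ := (ZMod.intCast_eq_intCast_iff_dvd_sub k l N).mp h
  have : l = k + d * N := by linarith
  rw [this]
  exact (hp.int_mul d k).symm

lemma mem_Rw_iff {a : ℝ} (i : Fin 2) (u v : ℝ) :
    (u, v + a - 1) ∈ Rw i ↔
      (i = 0 → 1 ≤ u ∧ v ≤ -a) ∧ (i = 1 → u ≤ 0 ∧ -a + 1 ≤ v) := by
  have e1 : v + a - 1 ≤ -1 ↔ v ≤ -a := by constructor <;> intro h <;> linarith
  have e2 : 0 ≤ v + a - 1 ↔ -a + 1 ≤ v := by constructor <;> intro h <;> linarith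
  fin_cases i <;> simp [Rw, Rzero, Rone, e1, e2]

section Correspondence

variable {a : ℝ} {N : ℕ} {W : ZMod N → Fin 2} {w : ℤ → Fin 2}

/-- The point of the plane at which a cyclic orbit starts. -/
def startPoint (a : ℝ) (x : ZMod N → ℝ) : ℝ × ℝ := (x 0, x (-1) + a - 1)

lemma IsCyclicOrbit.ne_one (ha : a < -1) {x : ZMod N → ℝ} (hx : IsCyclicOrbit (-a) W x)
    (k : ZMod N) : x k ≠ 1 := by
  intro h
  have h1 := (hx k).2.2
  rw [h, sub_self, mul_zero] at h1
  by_cases h0 : W k = 0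
  · have := ((hx k).1 h0).2
    exact mul_ne_zero (by linarith) (by linarith) h1.symm
  · have := ((hx k).2.1 (fin_two_eq_one h0)).1
    linarith

lemma IsCyclicOrbit.iterate_startPoint (ha : a < -1) {x : ZMod N → ℝ}
    (hx : IsCyclicOrbit (-a) W x) (k : ℕ) :
    (birat a)^[k] (startPoint a x) = (x k, x (k - 1) + a - 1) := by
  induction k with
  | zero => simp [startPoint]
  | succ k ih =>
    rw [Function.iterate_succ_apply', ih]
    have h1 := sub_ne_zero.mpr (hx.ne_one ha k)
    have h2 := (hx k).2.2
    simp only [birat, Nat.cast_add, Nat.cast_one, add_sub_cancel_right, Prod.mk.injEq, and_true]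
    rw [div_eq_iff h1, h2]
    ring

lemma IsCyclicOrbit.hasItinerary (ha : a < -1) {x : ZMod N → ℝ} (hx : IsCyclicOrbit (-a) W x)
    (hWw : ∀ k : ℤ, W k = w k) : HasItinerary a N w (startPoint a x) := by
  refine ⟨fun k _ => ?_, ?_, fun k _ => ?_⟩
  · rw [hx.iterate_startPoint ha]
    exact hx.ne_one ha k
  · rw [hx.iterate_startPoint ha]
    simp [startPoint]
  · rw [hx.iterate_startPoint ha, mem_Rw_iff, ← hWw]
    push_cast
    exact ⟨(hx k).1, (hx k).2.1⟩

lemma HasItinerary.exists_isCyclicOrbit [NeZero N] {p : ℝ × ℝ} (h : HasItinerary a N w p)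
    (hper : ∀ k : ℤ, w (k + (N : ℤ)) = w k) (hWw : ∀ k : ℤ, W k = w k) :
    ∃ x : ZMod N → ℝ, IsCyclicOrbit (-a) W x ∧ startPoint a x = p := by
  have hit := h.iterate NeZero.one_le hper
  have hmod : ∀ k : ℕ, (birat a)^[k % N] p = (birat a)^[k] p := fun k =>
    Function.IsPeriodicPt.iterate_mod_apply h.2.1 k
  set x : ZMod N → ℝ := fun k => ((birat a)^[k.val] p).1 with hxdef
  have hx : ∀ k : ℕ, x k = ((birat a)^[k] p).1 := fun k => by
    simp only [hxdef, ZMod.val_natCast, hmod]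
  have hx2 : ∀ k : ℕ, ((birat a)^[k] p).2 = x (k - 1) + a - 1 := fun k => by
    have e : ((k + (N - 1) : ℕ) : ZMod N) = k - 1 := by
      rw [Nat.cast_add, Nat.cast_sub NeZero.one_le]; simp [sub_eq_add_neg]
    have e2 : (birat a)^[k] p = birat a ((birat a)^[k + (N - 1)] p) := by
      rw [← Function.iterate_succ_apply' (birat a),
        show (k + (N - 1)).succ = k + N by have := NeZero.one_le (n := N); omega,
        Function.iterate_add_apply, h.2.1]
    rw [← e, hx, e2]
    rfl
  have hpt : ∀ k : ℕ, (birat a)^[k] p = (x k, x (k - 1) + a - 1) := fun k =>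
    Prod.ext (hx k).symm (hx2 k)
  refine ⟨x, fun k => ?_, ?_⟩
  · obtain ⟨n, rfl⟩ : ∃ n : ℕ, (n : ZMod N) = k := ⟨k.val, ZMod.natCast_zmod_val k⟩
    have h1 := hit n
    rw [hpt, mem_Rw_iff, ← hWw] at h1
    push_cast at h1
    refine ⟨h1.2.1, h1.2.2, ?_⟩
    have e := hx (n + 1)
    rw [Function.iterate_succ_apply', hpt] at e
    push_cast at e
    rw [e]
    simp only [birat]
    rw [div_mul_cancel₀ _ (sub_ne_zero.mpr h1.1)]
    ring
  · have := hpt 0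
    simp only [Function.iterate_zero, id, Nat.cast_zero, zero_sub] at this
    exact this.symm

end Correspondence

lemma existsUnique_hasItinerary {a : ℝ} (ha : a < -1) {N : ℕ} (hN : 1 ≤ N) {w : ℤ → Fin 2}
    (hadm : ∀ k : ℤ, ¬(w k = 1 ∧ w (k + 1) = 1)) (hper : ∀ k : ℤ, w (k + (N : ℤ)) = w k)
    (hnalt : ∃ k : ℤ, w k = w (k + 1)) : ∃! p : ℝ × ℝ, HasItinerary a N w p := by
  have : NeZero N := ⟨by omega⟩
  set W : ZMod N → Fin 2 := fun k => w (k.val : ℤ) with hWdef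
  have hWw : ∀ k : ℤ, W k = w k := fun k => periodic_word_mod hper (by simp)
  have hW : ∀ k, ¬(W k = 1 ∧ W (k + 1) = 1) := fun k => by
    have h := hadm (k.val : ℤ)
    rw [← hWw, ← hWw] at h
    simpa using h
  obtain ⟨k, hk⟩ := hnalt
  have hk0 : w k = 0 := by
    by_contra h
    have h := fin_two_eq_one h
    exact hadm k ⟨h, hk ▸ h⟩
  obtain ⟨x, hx, hu⟩ := existsUnique_isCyclicOrbit (c := -a) (by linarith) hW
    (j := ((k : ℤ) : ZMod N)) (by rw [hWw, hk0])
    (by rw [← Int.cast_one, ← Int.cast_add, hWw, ← hk, hk0])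
  refine ⟨startPoint a x, hx.hasItinerary ha hWw, fun q hq => ?_⟩
  obtain ⟨y, hy, rfl⟩ := hq.exists_isCyclicOrbit hper hWw
  rw [hu y hy]

lemma eq_of_mem_Rw {i j : Fin 2} {p : ℝ × ℝ} (hi : p ∈ Rw i) (hj : p ∈ Rw j) : i = j := by
  fin_cases i <;> fin_cases j <;> simp [Rw, Rzero, Rone] at hi hj ⊢ <;> linarith

lemma HasItinerary.iterate_eq_iff {a : ℝ} {N : ℕ} (hN : 1 ≤ N) {w : ℤ → Fin 2}
    (hper : ∀ k : ℤ, w (k + (N : ℤ)) = w k) {p : ℝ × ℝ} (h : HasItinerary a N w p)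
    (hu : ∀ q, HasItinerary a N w q → q = p) (m : ℕ) :
    (birat a)^[m] p = p ↔ ∀ k : ℤ, w (k + (m : ℤ)) = w k := by
  have hit := h.iterate hN hper
  constructor
  · intro hm k
    have : NeZero N := ⟨by omega⟩
    have hk : ((k : ℤ) : ZMod N) = (((k : ZMod N).val : ℕ) : ℤ) := by simp
    have hkm : ((k + m : ℤ) : ZMod N) = ((((k : ZMod N).val + m : ℕ)) : ℤ) := by simp
    rw [periodic_word_mod hper hk, periodic_word_mod hper hkm]
    refine eq_of_mem_Rw (hit _).2 ?_
    rw [Function.iterate_add_apply, hm]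
    exact (hit _).2
  · intro hm
    apply hu
    refine ⟨fun k _ => ?_, ?_, fun k _ => ?_⟩
    · rw [← Function.iterate_add_apply]; exact (hit _).1
    · rw [← Function.iterate_add_apply, add_comm, Function.iterate_add_apply, h.2.1]
    · rw [← Function.iterate_add_apply, ← hm]
      exact_mod_cast (hit (k + m)).2

theorem stmt9 (a : ℝ) (ha : a < -1) (N : ℕ) (hN : 1 ≤ N) (w : ℤ → Fin 2)
    (hadm : ∀ k : ℤ, ¬(w k = 1 ∧ w (k + 1) = 1))
    (hper : ∀ k : ℤ, w (k + (N : ℤ)) = w k)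
    (hnalt : ∃ k : ℤ, w k = w (k + 1)) :
    (∃! p : ℝ × ℝ, orbitDefined a p N ∧ (birat a)^[N] p = p ∧
        ∀ k : ℕ, k < N → (birat a)^[k] p ∈ Rw (w (k : ℤ))) ∧
    (∀ p : ℝ × ℝ, (orbitDefined a p N ∧ (birat a)^[N] p = p ∧
        ∀ k : ℕ, k < N → (birat a)^[k] p ∈ Rw (w (k : ℤ))) →
      sInf {m : ℕ | 1 ≤ m ∧ (birat a)^[m] p = p} =
        sInf {m : ℕ | 1 ≤ m ∧ ∀ k : ℤ, w (k + (m : ℤ)) = w k}) := by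
  obtain ⟨p, hp, hu⟩ := existsUnique_hasItinerary ha hN hadm hper hnalt
  refine ⟨⟨p, hp, hu⟩, fun q hq => ?_⟩
  obtain rfl := hu q hq
  simp only [hp.iterate_eq_iff hN hper hu]
end

section
/- For every integer n ≥ 1, the set Pₙ := {p ∈ ℂ² : the forward orbit of p is defined up to time n and fⁿ(p) = p} of finite periodic points of period dividing n is finite, every point of Pₙ has both coordinates real, and the cardinality of Pₙ equals F(n+1) + F(n−1) if n is odd, and F(n+1) + F(n−1) − 2 if n is even. -/
open Filter

/-- The complexified map on ℂ². -/
noncomputable def biratC (a : ℂ) (p : ℂ × ℂ) : ℂ × ℂ :=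
  (p.2 * (p.1 + a) / (p.1 - 1), p.1 + a - 1)

/-- A cyclic sequence of first coordinates of a periodic orbit, for the parameter `a = -b`. -/
def IsCycle {n : ℕ} {K : Type*} [Field K] (b : K) (x : ZMod n → K) : Prop :=
  ∀ k, x k ≠ 1 ∧ x (k + 1) * (x k - 1) = (1 + b - x (k - 1)) * (b - x k)

theorem ZMod.forall_of_forall_add_one {n : ℕ} [NeZero n] {P : ZMod n → Prop} {k₀ : ZMod n}
    (h₀ : P k₀) (h : ∀ k, P k → P (k + 1)) (k : ZMod n) : P k := by
  have key : ∀ m : ℕ, P (k₀ + m) := by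
    intro m
    induction m with
    | zero => simpa using h₀
    | succ m ih => simpa [add_assoc] using h _ ih
  simpa using key (k - k₀).val

namespace IsCycle

variable {n : ℕ} [NeZero n] {K : Type*} [Field K] [CharZero K] {b : K} {x : ZMod n → K}

theorem ne_param (hx : IsCycle b x) (hb : b ≠ 0) (hb' : b ≠ 1) (k : ZMod n) : x k ≠ b := by
  intro hk
  have hstep : ∀ j, x j - x (j - 1) + b = 0 → x (j + 1) - x (j + 1 - 1) + b = 0 := by
    intro j hj
    obtain ⟨h1, h2⟩ := hx j
    have h3 : (x (j + 1) - x j + b) * (x j - 1) = 0 := by linear_combination h2 - (x j - b) * hj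
    simpa [sub_ne_zero.2 h1] using h3
  have h0 : x (k + 1) - x (k + 1 - 1) + b = 0 := by
    have h2 := (hx k).2
    rw [hk, sub_self, mul_zero, mul_eq_zero, sub_eq_zero] at h2
    simp [h2.resolve_right hb', hk]
  have hall : ∀ j, x j - x (j - 1) + b = 0 := ZMod.forall_of_forall_add_one h0 hstep
  have hsum : ∑ j, (x j - x (j - 1) + b) = (n : K) * b := by
    have hshift : ∑ j, x (j - 1) = ∑ j, x j := (Equiv.subRight (1 : ZMod n)).sum_comp x
    rw [Finset.sum_add_distrib, Finset.sum_sub_distrib, hshift]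
    simp [ZMod.card]
  rw [Finset.sum_congr rfl fun j _ ↦ hall j] at hsum
  simp [hb, NeZero.ne n] at hsum

theorem reverse (hx : IsCycle b x) (hb : b ≠ 0) (hb' : b ≠ 1) :
    IsCycle b fun k ↦ 1 + b - x (-k) := by
  intro k
  refine ⟨fun h ↦ hx.ne_param hb hb' (-k) (by linear_combination -h), ?_⟩
  have h := (hx (-k)).2
  have e1 : -(k + 1) = -k - 1 := by ring
  have e2 : -(k - 1) = -k + 1 := by ring
  simp only [e1, e2]
  linear_combination -h

end IsCycle

section Orbit

variable {n : ℕ} {a : ℝ}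

theorem iterate_biratC_of_isCycle {x : ZMod n → ℂ} (hx : IsCycle (-a : ℂ) x) (m : ℕ) :
    (biratC a)^[m] (x 0, x (-1) + a - 1) = (x m, x (m - 1) + a - 1) := by
  induction m with
  | zero => simp
  | succ m ih =>
    rw [Function.iterate_succ_apply', ih]
    obtain ⟨h1, h2⟩ := hx m
    have h3 : x m - 1 ≠ 0 := sub_ne_zero.2 h1
    simp only [biratC, Nat.cast_add, Nat.cast_one, add_sub_cancel_right, Prod.mk.injEq, and_true]
    rw [div_eq_iff h3]
    linear_combination -h2

variable [NeZero n]

theorem image_isCycle_eq_periodic :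
    (fun x : ZMod n → ℂ ↦ (x 0, x (-1) + a - 1)) '' {x | IsCycle (-a : ℂ) x} =
      {p : ℂ × ℂ | (∀ k < n, ((biratC (a : ℂ))^[k] p).1 ≠ 1) ∧
        (biratC (a : ℂ))^[n] p = p} := by
  ext p
  constructor
  · rintro ⟨x, hx, rfl⟩
    refine ⟨fun k _ ↦ ?_, ?_⟩
    · rw [iterate_biratC_of_isCycle hx]
      exact (hx k).1
    · rw [iterate_biratC_of_isCycle hx]
      simp
  · rintro ⟨hp, hper⟩
    have hper' : Function.IsPeriodicPt (biratC (a : ℂ)) n p := hper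
    set x : ZMod n → ℂ := fun k ↦ ((biratC a)^[k.val] p).1 with hxdef
    have hx : ∀ m : ℕ, x m = ((biratC a)^[m] p).1 := fun m ↦ by
      rw [hxdef]
      simp only [ZMod.val_natCast]
      rw [hper'.iterate_mod_apply]
    have hsnd : ∀ m : ℕ, ((biratC a)^[m + 1] p).2 = x m + a - 1 := fun m ↦ by
      rw [Function.iterate_succ_apply', hx]; rfl
    have hsnd' : ∀ m : ℕ, ((biratC a)^[m] p).2 = x (m - 1) + a - 1 := fun m ↦ by
      have h := hsnd (m + n - 1)
      have hn : m + n - 1 + 1 = m + n := Nat.sub_add_cancel (by have := NeZero.pos n; omega)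
      rw [hn, Function.iterate_add_apply, hper] at h
      rw [h, Nat.cast_sub (by have := NeZero.pos n; omega)]
      simp
    refine ⟨x, fun k ↦ ?_, ?_⟩
    · have h1 : x k ≠ 1 := hp _ (ZMod.val_lt k)
      refine ⟨h1, ?_⟩
      have h2 := hx (k.val + 1)
      have h4 := hx k.val
      have h5 := hsnd' k.val
      rw [Function.iterate_succ_apply'] at h2
      simp only [biratC, Nat.cast_add, Nat.cast_one, ZMod.natCast_zmod_val] at h2 h4 h5
      have h3 : ((biratC a)^[k.val] p).1 - 1 ≠ 0 := by rw [← h4]; exact sub_ne_zero.2 h1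
      rw [h2, h4, div_mul_cancel₀ _ h3, h5]
      ring
    · have h0 := hx 0
      have h1 := hsnd' 0
      simp at h0 h1
      exact Prod.ext h0 h1.symm

end Orbit

section CyclicInequality

theorem ZMod.sum_add_one {n : ℕ} [NeZero n] {M : Type*} [AddCommMonoid M] (f : ZMod n → M) :
    ∑ k, f (k + 1) = ∑ k, f k :=
  Equiv.sum_comp (Equiv.addRight (1 : ZMod n)) f

theorem ZMod.sum_sub_one {n : ℕ} [NeZero n] {M : Type*} [AddCommMonoid M] (f : ZMod n → M) :
    ∑ k, f (k - 1) = ∑ k, f k :=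
  Equiv.sum_comp (Equiv.subRight (1 : ZMod n)) f

theorem cyclic_angle_dichotomy {n : ℕ} [NeZero n] {c : ℝ} {θ ξ η s : ZMod n → ℝ}
    (hξ : ∀ k, 0 ≤ ξ k) (hη : ∀ k, 0 ≤ η k) (hle : ∀ k, ξ k + η k ≤ θ k) (hc : ∀ k, θ k ≤ c)
    (hs : ∀ k, s k = 1 ∨ s k = -1)
    (H : ∀ k, θ k ≤ s (k - 1) * η (k - 1) + s k * ξ (k + 1) ∨
      (s (k - 1) = -1 ∧ s k = -1 ∧ 2 * c ≤ θ k + η (k - 1) + ξ (k + 1))) :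
    (∀ k, θ k = ξ k + η k) ∨ ∃ k, θ k = c ∧ ξ (k + 1) = c := by
  classical
  set N : ZMod n → Prop := fun k ↦ θ k ≤ s (k - 1) * η (k - 1) + s k * ξ (k + 1) with hN
  have hW : ∀ k, ¬ N k → s (k - 1) = -1 ∧ s k = -1 ∧ 2 * c ≤ θ k + η (k - 1) + ξ (k + 1) :=
    fun k hk ↦ (H k).resolve_left hk
  set g : ZMod n → ℝ := fun j ↦ (if N j then θ j else 0) - (if N (j + 1) then s j * η j else 0) -
    (if N (j - 1) then s (j - 1) * ξ j else 0) with hg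
  have hg0 : ∀ j, 0 ≤ g j := by
    intro j
    by_cases hj : N j
    · have h1 : (if N (j + 1) then s j * η j else 0) ≤ η j := by
        split_ifs
        · rcases hs j with h | h <;> rw [h] <;> linarith [hη j]
        · exact hη j
      have h2 : (if N (j - 1) then s (j - 1) * ξ j else 0) ≤ ξ j := by
        split_ifs
        · rcases hs (j - 1) with h | h <;> rw [h] <;> linarith [hξ j]
        · exact hξ j
      simp only [hg, if_pos hj]
      linarith [hle j]
    · obtain ⟨h1, h2, -⟩ := hW j hj
      simp only [hg, if_neg hj, h1, h2]
      split_ifs <;> linarith [hξ j, hη j]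
  have hgsum : ∑ j, g j ≤ 0 := by
    have e1 : ∑ j, (if N (j + 1) then s j * η j else 0) =
        ∑ j, (if N j then s (j - 1) * η (j - 1) else 0) := by
      rw [← ZMod.sum_add_one fun j ↦ if N j then s (j - 1) * η (j - 1) else 0]
      simp
    have e2 : ∑ j, (if N (j - 1) then s (j - 1) * ξ j else 0) =
        ∑ j, (if N j then s j * ξ (j + 1) else 0) := by
      rw [← ZMod.sum_sub_one fun j ↦ if N j then s j * ξ (j + 1) else 0]
      simp
    rw [hg, Finset.sum_sub_distrib, Finset.sum_sub_distrib, e1, e2, ← Finset.sum_sub_distrib,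
      ← Finset.sum_sub_distrib]
    refine Finset.sum_nonpos fun k _ ↦ ?_
    split_ifs with hk
    · have : θ k ≤ s (k - 1) * η (k - 1) + s k * ξ (k + 1) := hk
      linarith
    · simp
  have hgz : ∀ j, g j = 0 := fun j ↦
    (Finset.sum_eq_zero_iff_of_nonneg fun i _ ↦ hg0 i).1
      (le_antisymm hgsum (Finset.sum_nonneg fun i _ ↦ hg0 i)) j (Finset.mem_univ j)
  by_cases hall : ∀ k, N k
  · left
    intro k
    have h := hgz k
    simp only [hg, hall, if_true] at h
    have h1 : s k * η k ≤ η k := by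
      rcases hs k with h | h <;> rw [h] <;> linarith [hη k]
    have h2 : s (k - 1) * ξ k ≤ ξ k := by
      rcases hs (k - 1) with h | h <;> rw [h] <;> linarith [hξ k]
    linarith [hle k]
  by_cases hmix : ∃ k, N k ∧ ¬ N (k + 1)
  · obtain ⟨k, hk, hk'⟩ := hmix
    have h := hgz k
    have h2 : (if N (k - 1) then s (k - 1) * ξ k else 0) ≤ ξ k := by
      split_ifs
      · rcases hs (k - 1) with h | h <;> rw [h] <;> linarith [hξ k]
      · exact hξ k
    simp only [hg, if_pos hk, if_neg hk'] at h
    obtain ⟨-, -, h3⟩ := hW _ hk'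
    rw [add_sub_cancel_right] at h3
    have h4 := hle (k + 1 + 1)
    have h5 := hc (k + 1 + 1)
    have h6 := hη (k + 1 + 1)
    have h7 := hc (k + 1)
    exact Or.inr ⟨k + 1, by linarith [hle k], by linarith [hle k]⟩
  · left
    push Not at hall hmix
    obtain ⟨k₀, hk₀⟩ := hall
    have hno : ∀ k, ¬ N k := fun k hk ↦ hk₀ (ZMod.forall_of_forall_add_one hk hmix k₀)
    have e : ∑ k, (2 * c - θ k - η k - ξ k) = ∑ k, (2 * c - θ k - η (k - 1) - ξ (k + 1)) := by
      simp only [Finset.sum_sub_distrib, ZMod.sum_sub_one η, ZMod.sum_add_one ξ]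
    have h1 : ∑ k, (2 * c - θ k - η k - ξ k) ≤ 0 := by
      rw [e]
      exact Finset.sum_nonpos fun k _ ↦ by linarith [(hW k (hno k)).2.2]
    have h2 : ∀ k, 0 ≤ 2 * c - θ k - η k - ξ k := fun k ↦ by linarith [hle k, hc k]
    intro k
    have h3 := (Finset.sum_eq_zero_iff_of_nonneg fun i _ ↦ h2 i).1
      (le_antisymm h1 (Finset.sum_nonneg fun i _ ↦ h2 i)) k (Finset.mem_univ k)
    linarith [hle k, hc k]

end CyclicInequality

namespace Complex

theorem arg_lt_arg_sub_ofReal {u : ℂ} (hu : 0 < u.im) {r : ℝ} (hr : 0 < r) :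
    arg u < arg (u - r) := by
  have hv : 0 < (u - r).im := by simpa
  have hu0 : u ≠ 0 := fun h ↦ by simp [h] at hu
  have hv0 : u - r ≠ 0 := fun h ↦ by simp [h] at hv
  by_contra! h
  have h1 : Real.sin (arg u - arg (u - r)) < 0 := by
    rw [Real.sin_sub, sin_arg, sin_arg, cos_arg hu0, cos_arg hv0]
    have h2 : 0 < ‖u‖ := norm_pos_iff.2 hu0
    have h3 : 0 < ‖u - r‖ := norm_pos_iff.2 hv0
    have e : u.im / ‖u‖ * ((u - r).re / ‖u - r‖) - u.re / ‖u‖ * ((u - r).im / ‖u - r‖) =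
        -(r * u.im / (‖u‖ * ‖u - r‖)) := by
      simp only [sub_re, sub_im, ofReal_re, ofReal_im, sub_zero]
      field_simp
      ring
    rw [e, neg_lt_zero]
    positivity
  have h4 : 0 ≤ arg (u - r) := arg_nonneg_iff.2 hv.le
  exact h1.not_ge (Real.sin_nonneg_of_nonneg_of_le_pi (by linarith) (by linarith [arg_le_pi u]))

theorem abs_arg_conj (z : ℂ) : |arg ((starRingEnd ℂ) z)| = |arg z| := by
  rw [arg_conj]
  split_ifs with h <;> simp [h]

/-- The absolute value of the argument, with value `π` at `0`. -/
noncomputable def absArg (z : ℂ) : ℝ := if z = 0 then Real.pi else |arg z|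

theorem absArg_zero : absArg 0 = Real.pi := if_pos rfl

theorem absArg_of_ne_zero {z : ℂ} (hz : z ≠ 0) : absArg z = |arg z| := if_neg hz

theorem absArg_nonneg (z : ℂ) : 0 ≤ absArg z := by
  unfold absArg
  split_ifs
  · exact Real.pi_pos.le
  · positivity

theorem absArg_conj (z : ℂ) : absArg ((starRingEnd ℂ) z) = absArg z := by
  simp [absArg, abs_arg_conj]

theorem absArg_le_pi (z : ℂ) : absArg z ≤ Real.pi := by
  unfold absArg
  split_ifs
  · exact le_rfl
  · exact abs_arg_le_pi z

theorem absArg_ofReal_of_pos {r : ℝ} (hr : 0 < r) : absArg r = 0 := by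
  rw [absArg_of_ne_zero (by exact_mod_cast hr.ne'), arg_ofReal_of_nonneg hr.le, abs_zero]

theorem abs_arg_ofReal_of_neg {r : ℝ} (hr : r < 0) : |arg r| = Real.pi := by
  rw [arg_ofReal_of_neg hr, abs_of_pos Real.pi_pos]

theorem coe_arg_eq_sign_mul_abs_arg {w : ℂ} {σ : ℝ}
    (h : σ = 1 ∧ 0 ≤ w.im ∨ σ = -1 ∧ w.im ≤ 0) :
    (arg w : Real.Angle) = ((σ * |arg w| : ℝ) : Real.Angle) := by
  rcases h with ⟨rfl, h⟩ | ⟨rfl, h⟩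
  · rw [abs_of_nonneg (arg_nonneg_iff.2 h), one_mul]
  · rcases h.lt_or_eq with h | h
    · rw [abs_of_neg (arg_neg_iff.2 h)]
      simp
    · by_cases hre : 0 ≤ w.re
      · rw [arg_eq_zero_iff.2 ⟨hre, h⟩]
        simp
      · rw [arg_eq_pi_iff.2 ⟨not_le.1 hre, h⟩, abs_of_pos Real.pi_pos]
        simp [Real.Angle.neg_coe_pi]

theorem absArg_add_absArg_lt_of_im_pos {b : ℝ} (hb : 0 < b) (hb' : b ≠ 1) {z : ℂ}
    (hz : 0 < z.im) :
    absArg z + absArg (1 + b - z) < |arg ((z - 1) / (b - z))| ∧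
      |arg ((z - 1) / (b - z))| < Real.pi := by
  have hz1 : 0 < (z - 1).im := by simpa
  have hzb : 0 < (z - b).im := by simpa
  have hzE : 0 < (z - 1 - b).im := by simpa
  have ne : ∀ {w : ℂ}, 0 < w.im → w ≠ 0 := fun {w} h h' ↦ by simp [h'] at h
  have e1 : (b : ℂ) - z = -(z - b) := by ring
  have e2 : (1 : ℂ) + b - z = -(z - 1 - b) := by ring
  have hξ : absArg z = arg z := by
    rw [absArg_of_ne_zero (ne hz), abs_of_nonneg (arg_nonneg_iff.2 hz.le)]
  have hη : absArg (1 + b - z) = Real.pi - arg (z - 1 - b) := by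
    rw [e2, absArg_of_ne_zero (neg_ne_zero.2 (ne hzE)), arg_neg_eq_arg_sub_pi_of_im_pos hzE,
      abs_of_nonpos (by linarith [arg_le_pi (z - 1 - b)])]
    ring
  have hA := arg_lt_arg_sub_ofReal hz one_pos
  have hB := arg_lt_arg_sub_ofReal hz hb
  have hAE := arg_lt_arg_sub_ofReal hz1 hb
  have hBE := arg_lt_arg_sub_ofReal hzb one_pos
  have e3 : z - (b : ℂ) - 1 = z - 1 - b := by ring
  simp only [ofReal_one, e3] at hA hBE
  have h0 : 0 < arg z := (arg_nonneg_iff.2 hz.le).lt_of_ne' fun h ↦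
    hz.ne' (arg_eq_zero_iff.1 h).2
  have hπ := arg_le_pi (z - 1 - b)
  have hT : (arg ((z - 1) / (b - z)) : Real.Angle) =
      ((arg (z - 1) - (arg (z - b) - Real.pi) : ℝ) : Real.Angle) := by
    rw [arg_div_coe_angle (ne hz1) (by rw [e1]; exact neg_ne_zero.2 (ne hzb)), e1,
      arg_neg_eq_arg_sub_pi_of_im_pos hzb]
    simp
  rw [hξ, hη]
  rcases lt_or_gt_of_ne hb' with h | h
  · have hBA := arg_lt_arg_sub_ofReal hzb (sub_pos.2 h)
    have e4 : z - (b : ℂ) - ((1 - b : ℝ) : ℂ) = z - 1 := by push_cast; ring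
    rw [e4] at hBA
    have hT' : arg ((z - 1) / (b - z)) = arg (z - 1) - arg (z - b) - Real.pi := by
      rw [← arg_coe_angle_toReal_eq_arg, hT]
      have e5 : ((arg (z - 1) - (arg (z - b) - Real.pi) : ℝ) : Real.Angle) =
          ((arg (z - 1) - arg (z - b) - Real.pi : ℝ) : Real.Angle) := by
        rw [Real.Angle.angle_eq_iff_two_pi_dvd_sub]
        exact ⟨1, by push_cast; ring⟩
      rw [e5, Real.Angle.toReal_coe_eq_self_iff]
      constructor <;> linarith
    rw [hT', abs_of_neg (by linarith)]
    constructor <;> linarith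
  · have hAB := arg_lt_arg_sub_ofReal hz1 (sub_pos.2 h)
    have e4 : z - 1 - ((b - 1 : ℝ) : ℂ) = z - b := by push_cast; ring
    rw [e4] at hAB
    have hT' : arg ((z - 1) / (b - z)) = arg (z - 1) - (arg (z - b) - Real.pi) := by
      rw [← arg_coe_angle_toReal_eq_arg, hT, Real.Angle.toReal_coe_eq_self_iff]
      constructor <;> linarith
    rw [hT', abs_of_pos (by linarith)]
    constructor <;> linarith

theorem absArg_add_absArg_lt {b : ℝ} (hb : 0 < b) (hb' : b ≠ 1) {z : ℂ} (hz : z.im ≠ 0) :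
    absArg z + absArg (1 + b - z) < |arg ((z - 1) / (b - z))| ∧
      |arg ((z - 1) / (b - z))| < Real.pi := by
  rcases hz.lt_or_gt with h | h
  · have key := absArg_add_absArg_lt_of_im_pos hb hb' (z := (starRingEnd ℂ) z) (by simpa)
    have e1 : (1 : ℂ) + b - (starRingEnd ℂ) z = (starRingEnd ℂ) (1 + b - z) := by simp
    have e2 : ((starRingEnd ℂ) z - 1) / (b - (starRingEnd ℂ) z) =
      (starRingEnd ℂ) ((z - 1) / (b - z)) := by simp
    rwa [e1, e2, absArg_conj, absArg_conj, abs_arg_conj] at key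
  · exact absArg_add_absArg_lt_of_im_pos hb hb' h

theorem absArg_add_absArg_le {b : ℝ} (hb : 0 < b) (hb' : b ≠ 1) {z : ℂ} (hz1 : z ≠ 1)
    (hzb : z ≠ b) : absArg z + absArg (1 + b - z) ≤ |arg ((z - 1) / (b - z))| := by
  by_cases hz : z.im = 0
  · obtain ⟨r, rfl⟩ : ∃ r : ℝ, z = r := ⟨z.re, by apply Complex.ext <;> simp [hz]⟩
    have h1 : r ≠ 1 := by exact_mod_cast hz1
    have h2 : r ≠ b := by exact_mod_cast hzb
    have e1 : (1 : ℂ) + b - r = ((1 + b - r : ℝ) : ℂ) := by push_cast; ring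
    have e2 : ((r : ℂ) - 1) / (b - r) = (((r - 1) / (b - r) : ℝ) : ℂ) := by push_cast; ring
    rw [e1, e2]
    have h3 : (r - 1) / (b - r) ≠ 0 := div_ne_zero (sub_ne_zero.2 h1) (sub_ne_zero.2 h2.symm)
    rcases h3.lt_or_gt with h | h
    · rw [abs_arg_ofReal_of_neg h]
      by_cases hr : 0 < r
      · rw [absArg_ofReal_of_pos hr, zero_add]
        exact absArg_le_pi _
      · rw [absArg_ofReal_of_pos (r := 1 + b - r) (by linarith), add_zero]
        exact absArg_le_pi _
    · rw [absArg_ofReal_of_pos, absArg_ofReal_of_pos, add_zero]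
      · positivity
      all_goals rcases div_pos_iff.1 h with ⟨h4, h5⟩ | ⟨h4, h5⟩ <;> linarith
  · exact (absArg_add_absArg_lt hb hb' hz).1.le

end Complex

namespace Complex

theorem angle_relation {X T Y : ℂ} (hT : T ≠ 0) (hXY : X * T = Y) {α β τ : ℝ}
    (hX : α = 1 ∧ 0 ≤ X.im ∨ α = -1 ∧ X.im < 0) (hT' : τ = 1 ∧ 0 ≤ T.im ∨ τ = -1 ∧ T.im ≤ 0)
    (hY : β = 1 ∧ Y.im ≤ 0 ∨ β = -1 ∧ 0 < Y.im) :
    |arg T| ≤ -(τ * β) * absArg Y + -(τ * α) * absArg X ∨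
      (-(τ * β) = -1 ∧ -(τ * α) = -1 ∧ 2 * Real.pi ≤ |arg T| + absArg Y + absArg X) ∨
      (|arg T| = Real.pi ∧ absArg Y = Real.pi) ∨ (|arg T| = Real.pi ∧ absArg X = Real.pi) := by
  have hα : α = 1 ∨ α = -1 := hX.imp And.left And.left
  have hβ : β = 1 ∨ β = -1 := hY.imp And.left And.left
  have hτ : τ = 1 ∨ τ = -1 := hT'.imp And.left And.left
  have hTπ := abs_arg_le_pi T
  have hT0 := abs_nonneg (arg T)
  by_cases hX0 : X = 0
  · subst hX0
    rw [zero_mul] at hXY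
    subst hXY
    have hα1 : α = 1 := by simpa using hX
    have hβ1 : β = 1 := by simpa using hY
    subst hα1 hβ1
    rw [absArg_zero]
    rcases hτ with rfl | rfl
    · exact Or.inr (Or.inl ⟨by norm_num, by norm_num, by linarith⟩)
    · exact Or.inl (by linarith)
  have hY0 : Y ≠ 0 := hXY ▸ mul_ne_zero hX0 hT
  have e := arg_mul_coe_angle hX0 hT
  have hX' : α = 1 ∧ 0 ≤ X.im ∨ α = -1 ∧ X.im ≤ 0 := hX.imp_right fun h ↦ ⟨h.1, h.2.le⟩
  have hY' : -β = 1 ∧ 0 ≤ Y.im ∨ -β = -1 ∧ Y.im ≤ 0 := by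
    rcases hY with ⟨rfl, h⟩ | ⟨rfl, h⟩
    · exact Or.inr ⟨rfl, h⟩
    · exact Or.inl ⟨by norm_num, h.le⟩
  rw [hXY, coe_arg_eq_sign_mul_abs_arg hX', coe_arg_eq_sign_mul_abs_arg hT',
    coe_arg_eq_sign_mul_abs_arg hY', ← Real.Angle.coe_add,
    Real.Angle.angle_eq_iff_two_pi_dvd_sub] at e
  obtain ⟨m, hm⟩ := e
  rw [absArg_of_ne_zero hX0, absArg_of_ne_zero hY0]
  have hπ := Real.pi_pos
  have hXπ := abs_arg_le_pi X
  have hYπ := abs_arg_le_pi Y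
  have hX0' := abs_nonneg (arg X)
  have hY0' := abs_nonneg (arg Y)
  generalize |arg X| = ξ at *
  generalize |arg Y| = η at *
  generalize |arg T| = θ at *
  obtain ⟨M, hM⟩ : ∃ M : ℤ, θ - -(τ * β) * η - -(τ * α) * ξ = 2 * Real.pi * M := by
    rcases hτ with rfl | rfl
    · exact ⟨-m, by push_cast; linarith⟩
    · exact ⟨m, by linarith⟩
  have hp : -(τ * β) = 1 ∨ -(τ * β) = -1 := by
    rcases hτ with rfl | rfl <;> rcases hβ with rfl | rfl <;> norm_num
  have hq : -(τ * α) = 1 ∨ -(τ * α) = -1 := by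
    rcases hτ with rfl | rfl <;> rcases hα with rfl | rfl <;> norm_num
  generalize -(τ * β) = p at *
  generalize -(τ * α) = q at *
  rcases le_or_gt M 0 with h | h
  · left
    have h1 : (M : ℝ) ≤ 0 := by exact_mod_cast h
    nlinarith
  · have h1 : (1 : ℝ) ≤ M := by exact_mod_cast h
    have h2 : 2 * Real.pi ≤ 2 * Real.pi * M := by nlinarith
    rcases hp with rfl | rfl <;> rcases hq with rfl | rfl
    · left; linarith
    · exact Or.inr (Or.inr (Or.inr ⟨by linarith, by linarith⟩))
    · exact Or.inr (Or.inr (Or.inl ⟨by linarith, by linarith⟩))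
    · exact Or.inr (Or.inl ⟨rfl, rfl, by linarith⟩)

theorem im_sub_one_div_sub {b : ℝ} {z : ℂ} :
    ((z - 1) / (b - z)).im = (b - 1) * z.im / normSq (b - z) := by
  rw [div_im]
  simp only [sub_im, one_im, sub_zero, sub_re, ofReal_re, one_re, ofReal_im, zero_sub]
  ring

end Complex

namespace IsCycle

variable {n : ℕ} [NeZero n] {b : ℝ} {x : ZMod n → ℂ}

theorem im_eq_zero_of_adjacent (hx : IsCycle (b : ℂ) x) {k₀ : ZMod n} (h₀ : (x k₀).im = 0)
    (h₁ : (x (k₀ + 1)).im = 0) (k : ZMod n) : (x k).im = 0 := by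
  refine (ZMod.forall_of_forall_add_one (P := fun k ↦ (x k).im = 0 ∧ (x (k + 1)).im = 0)
    ⟨h₀, h₁⟩ (fun k hk ↦ ⟨hk.2, ?_⟩) k).1
  obtain ⟨hk0, hk1⟩ := hk
  obtain ⟨h2, h3⟩ := hx (k + 1)
  rw [add_sub_cancel_right] at h3
  have h4 := congrArg Complex.im h3
  simp only [Complex.mul_im, Complex.sub_im, Complex.sub_re, Complex.add_im, Complex.add_re,
    Complex.ofReal_im, Complex.ofReal_re, Complex.one_im, Complex.one_re, hk0, hk1] at h4
  have h5 : (x (k + 1 + 1)).im * ((x (k + 1)).re - 1) = 0 := by linarith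
  refine (mul_eq_zero.1 h5).resolve_right fun h ↦ h2 ?_
  apply Complex.ext
  · simpa [sub_eq_zero] using h
  · simpa using hk1

theorem im_eq_zero (hx : IsCycle (b : ℂ) x) (hb : 0 < b) (hb' : b ≠ 1) (k : ZMod n) :
    (x k).im = 0 := by
  have hxb : ∀ k, x k ≠ b := hx.ne_param (by exact_mod_cast hb.ne') (by exact_mod_cast hb')
  set T : ZMod n → ℂ := fun k ↦ (x k - 1) / (b - x k) with hT
  have hT0 : ∀ k, T k ≠ 0 := fun k ↦
    div_ne_zero (sub_ne_zero.2 (hx k).1) (sub_ne_zero.2 (hxb k).symm)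
  have hXT : ∀ k, x (k + 1) * T k = 1 + b - x (k - 1) := fun k ↦ by
    have h : (b : ℂ) - x k ≠ 0 := sub_ne_zero.2 (hxb k).symm
    rw [hT]
    field_simp
    linear_combination (hx k).2
  set σ : ZMod n → ℝ := fun k ↦ if 0 ≤ (x k).im then 1 else -1 with hσ
  have hσ' : ∀ k, σ k = 1 ∧ 0 ≤ (x k).im ∨ σ k = -1 ∧ (x k).im < 0 := fun k ↦ by
    rcases le_or_gt 0 (x k).im with h | h
    · exact Or.inl ⟨if_pos h, h⟩
    · exact Or.inr ⟨if_neg h.not_ge, h⟩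
  obtain ⟨τ, hτ⟩ : ∃ τ : ℝ, τ = 1 ∧ 0 ≤ b - 1 ∨ τ = -1 ∧ b - 1 ≤ 0 := by
    rcases le_total 0 (b - 1) with h | h
    · exact ⟨1, Or.inl ⟨rfl, h⟩⟩
    · exact ⟨-1, Or.inr ⟨rfl, h⟩⟩
  have hτT : ∀ k, τ * σ k = 1 ∧ 0 ≤ (T k).im ∨ τ * σ k = -1 ∧ (T k).im ≤ 0 := fun k ↦ by
    rw [hT]
    simp only [Complex.im_sub_one_div_sub]
    have h0 := Complex.normSq_nonneg (b - x k)
    rcases hσ' k with ⟨h1, h2⟩ | ⟨h1, h2⟩ <;> rcases hτ with ⟨h3, h4⟩ | ⟨h3, h4⟩ <;> rw [h1, h3]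
    · exact Or.inl ⟨by norm_num, by positivity⟩
    · exact Or.inr ⟨by norm_num, div_nonpos_of_nonpos_of_nonneg (by nlinarith) h0⟩
    · exact Or.inr ⟨by norm_num, div_nonpos_of_nonpos_of_nonneg (by nlinarith) h0⟩
    · exact Or.inl ⟨by norm_num, div_nonneg (by nlinarith) h0⟩
  have him : ∀ k, |Complex.arg (T k)| = Real.pi → (x k).im = 0 := fun k h ↦ by
    by_contra h'
    exact (Complex.absArg_add_absArg_lt hb hb' h').2.ne h
  have himX : ∀ k, Complex.absArg (x k) = Real.pi → (x k).im = 0 := fun k h ↦ by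
    by_contra h'
    have := Complex.absArg_add_absArg_lt hb hb' h'
    linarith [Complex.absArg_nonneg (1 + b - x k)]
  have himY : ∀ k, Complex.absArg (1 + b - x k) = Real.pi → (x k).im = 0 := fun k h ↦ by
    by_contra h'
    have := Complex.absArg_add_absArg_lt hb hb' h'
    linarith [Complex.absArg_nonneg (x k)]
  by_contra hk
  have hfwd : ∀ j, ¬ (|Complex.arg (T j)| = Real.pi ∧ Complex.absArg (x (j + 1)) = Real.pi) :=
    fun j h ↦ hk (hx.im_eq_zero_of_adjacent (him j h.1) (himX _ h.2) k)
  have hbwd : ∀ j, ¬ (|Complex.arg (T j)| = Real.pi ∧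
      Complex.absArg (1 + b - x (j - 1)) = Real.pi) := fun j h ↦
    hk (hx.im_eq_zero_of_adjacent (himY _ h.2) (by simpa using him j h.1) k)
  have key := cyclic_angle_dichotomy (c := Real.pi) (θ := fun k ↦ |Complex.arg (T k)|)
    (ξ := fun k ↦ Complex.absArg (x k)) (η := fun k ↦ Complex.absArg (1 + b - x k))
    (s := fun k ↦ -(τ * σ k * σ (k + 1))) (fun k ↦ Complex.absArg_nonneg _)
    (fun k ↦ Complex.absArg_nonneg _)
    (fun k ↦ Complex.absArg_add_absArg_le hb hb' (hx k).1 (hxb k))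
    (fun k ↦ Complex.abs_arg_le_pi _)
    (fun k ↦ by
      rcases hσ' (k + 1) with ⟨h1, -⟩ | ⟨h1, -⟩ <;> rcases hτT k with ⟨h2, -⟩ | ⟨h2, -⟩ <;>
        rw [h1, h2] <;> norm_num)
    (fun k ↦ by
      have hY : σ (k - 1) = 1 ∧ (1 + b - x (k - 1)).im ≤ 0 ∨
          σ (k - 1) = -1 ∧ 0 < (1 + b - x (k - 1)).im := by simpa using hσ' (k - 1)
      have h := Complex.angle_relation (hT0 k) (hXT k) (hσ' (k + 1)) (hτT k) hY
      have e : τ * σ (k - 1) * σ (k - 1 + 1) = τ * σ k * σ (k - 1) := by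
        rw [sub_add_cancel]; ring
      simp only [e]
      rcases h with h | h | h | h
      · exact Or.inl h
      · exact Or.inr h
      · exact (hbwd k h).elim
      · exact (hfwd k h).elim)
  rcases key with h | ⟨j, hj⟩
  · exact (Complex.absArg_add_absArg_lt hb hb' hk).1.ne' (h k)
  · exact hfwd j hj

end IsCycle

section LogInequalities

theorem log_add_sub_log_add_lt {u v d e : ℝ} (hu : 0 < u) (huv : u < v) (hd : 0 ≤ d)
    (hde : d < e) :
    Real.log (v + e) - Real.log (u + e) < Real.log (v + d) - Real.log (u + d) := by
  have h1 : 0 < u + d := by linarith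
  have h2 : 0 < v + d := by linarith
  have h3 : 0 < u + e := by linarith
  have h4 : 0 < v + e := by linarith
  rw [← Real.log_div h4.ne' h3.ne', ← Real.log_div h2.ne' h1.ne']
  apply Real.log_lt_log (by positivity)
  rw [div_lt_div_iff₀ h3 h1]
  nlinarith [mul_pos (sub_pos.2 huv) (sub_pos.2 hde)]

theorem abs_log_ratio_add_abs_log_lt {b t t' : ℝ} (hb : 0 < b) (ht : 0 < t) (ht' : 0 < t')
    (h : t ≠ t') :
    |(Real.log (1 + t') - Real.log (b + t')) - (Real.log (1 + t) - Real.log (b + t))| +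
      |Real.log (1 + b + t') - Real.log (1 + b + t)| < |Real.log t' - Real.log t| := by
  wlog hlt : t < t' generalizing t t'
  · have := this ht' ht h.symm (h.symm.lt_of_le (not_lt.1 hlt))
    rwa [abs_sub_comm, abs_sub_comm (Real.log (1 + b + t)), abs_sub_comm (Real.log t)] at this
  have h0 : Real.log t < Real.log t' := Real.log_lt_log ht hlt
  have h1 : Real.log (1 + b + t) < Real.log (1 + b + t') :=
    Real.log_lt_log (by linarith) (by linarith)
  have k1 := log_add_sub_log_add_lt ht hlt le_rfl one_pos
  have k2 := log_add_sub_log_add_lt ht hlt le_rfl hb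
  have k3 := log_add_sub_log_add_lt ht hlt zero_le_one (show 1 < 1 + b by linarith)
  have k4 := log_add_sub_log_add_lt ht hlt hb.le (show b < 1 + b by linarith)
  simp only [add_zero] at k1 k2
  rw [abs_of_pos (sub_pos.2 h0), abs_of_pos (sub_pos.2 h1), add_comm 1 t, add_comm 1 t',
    add_comm b t, add_comm b t', add_comm (1 + b) t, add_comm (1 + b) t']
  rw [← lt_sub_iff_add_lt, abs_lt]
  constructor <;> linarith

theorem abs_log_add_abs_log_lt {b T T' : ℝ} (hb : 0 < b) (hT : 0 < T) (hT' : 0 < T')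
    (h : T ≠ T') :
    |Real.log ((1 + b * T') / (1 + T')) - Real.log ((1 + b * T) / (1 + T))| +
      |Real.log ((b + T') / (1 + T')) - Real.log ((b + T) / (1 + T))| <
      |Real.log T' - Real.log T| := by
  wlog hlt : T < T' generalizing T T'
  · have := this hT' hT h.symm (h.symm.lt_of_le (not_lt.1 hlt))
    rwa [abs_sub_comm, abs_sub_comm (Real.log ((b + T) / (1 + T))),
      abs_sub_comm (Real.log T)] at this
  have h0 : Real.log T < Real.log T' := Real.log_lt_log hT hlt
  have e1 : ∀ S : ℝ, 0 < S →
      Real.log ((1 + b * S) / (1 + S)) = Real.log b + Real.log (S + 1 / b) - Real.log (S + 1) := by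
    intro S hS
    have e : 1 + b * S = b * (S + 1 / b) := by field_simp; ring
    rw [e, Real.log_div (by positivity) (by positivity), Real.log_mul hb.ne' (by positivity),
      add_comm 1 S]
  have e2 : ∀ S : ℝ, 0 < S →
      Real.log ((b + S) / (1 + S)) = Real.log (S + b) - Real.log (S + 1) := by
    intro S hS
    rw [Real.log_div (by positivity) (by positivity), add_comm b S, add_comm 1 S]
  rw [e1 T hT, e1 T' hT', e2 T hT, e2 T' hT', abs_of_pos (sub_pos.2 h0)]
  have hpos : ∀ d : ℝ, 0 < d → Real.log (T + d) < Real.log (T' + d) := fun d hd ↦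
    Real.log_lt_log (by linarith) (by linarith)
  have hb' : 0 < 1 / b := by positivity
  have k1 := log_add_sub_log_add_lt hT hlt le_rfl one_pos
  have k2 := log_add_sub_log_add_lt hT hlt le_rfl hb
  have k3 := log_add_sub_log_add_lt hT hlt le_rfl hb'
  simp only [add_zero] at k1 k2 k3
  have p1 := hpos 1 one_pos
  have p2 := hpos b hb
  have p3 := hpos (1 / b) hb'
  rcases lt_trichotomy b 1 with hb1 | rfl | hb1
  · have hb2 : 1 < 1 / b := by rw [lt_div_iff₀ hb]; linarith
    have k4 := log_add_sub_log_add_lt hT hlt hb.le hb1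
    have k5 := log_add_sub_log_add_lt hT hlt zero_le_one hb2
    rw [abs_of_neg (by linarith), abs_of_pos (by linarith)]
    linarith
  · simp only [one_div, inv_one]
    simpa using h0
  · have hb2 : 1 / b < 1 := by rw [div_lt_iff₀ hb]; linarith
    have k4 := log_add_sub_log_add_lt hT hlt zero_le_one hb1
    have k5 := log_add_sub_log_add_lt hT hlt hb'.le hb2
    rw [abs_of_pos (by linarith), abs_of_neg (by linarith)]
    linarith

end LogInequalities

namespace IsCycle

variable {n : ℕ} [NeZero n] {b : ℝ} {x : ZMod n → ℝ}

theorem one_add_le_of_nonpos (hx : IsCycle b x) (hb : 0 < b) {k : ZMod n}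
    (hk : x k ≤ 0) : 1 + b ≤ x (k - 1) := by
  by_contra! hk'
  have hstep : ∀ j, x j ≤ 0 ∧ x (j - 1) < 1 + b → x (j + 1) < 0 := fun j ⟨h1, h2⟩ ↦ by
    have h3 : 0 < (1 + b - x (j - 1)) * (b - x j) := mul_pos (by linarith) (by linarith)
    rw [← (hx j).2] at h3
    by_contra! h4
    nlinarith
  have hall : ∀ j, x j ≤ 0 ∧ x (j - 1) < 1 + b := ZMod.forall_of_forall_add_one ⟨hk, hk'⟩
    fun j hj ↦ ⟨(hstep j hj).le, by rw [add_sub_cancel_right]; linarith [hj.1]⟩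
  have hneg : ∀ j, x j < 0 := fun j ↦ by simpa using hstep (j - 1) (hall (j - 1))
  have hprod : ∏ j, (-x j * (1 - x j)) = ∏ j, ((1 + b - x j) * (b - x j)) := by
    have e1 : ∏ j, -x j = ∏ j, -x (j + 1) :=
      (Equiv.prod_comp (Equiv.addRight (1 : ZMod n)) fun j ↦ -x j).symm
    have e2 : ∏ j, (1 + b - x j) = ∏ j, (1 + b - x (j - 1)) :=
      (Equiv.prod_comp (Equiv.subRight (1 : ZMod n)) fun j ↦ 1 + b - x j).symm
    rw [Finset.prod_mul_distrib, Finset.prod_mul_distrib, e1, e2, ← Finset.prod_mul_distrib,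
      ← Finset.prod_mul_distrib]
    refine Finset.prod_congr rfl fun j _ ↦ ?_
    linear_combination (hx j).2
  refine hprod.not_lt (Finset.prod_lt_prod_of_nonempty (fun j _ ↦ ?_) (fun j _ ↦ ?_)
    Finset.univ_nonempty)
  · exact mul_pos (by linarith [hneg j]) (by linarith [hneg j])
  · nlinarith [hneg j]

theorem nonpos_of_one_add_le (hx : IsCycle b x) (hb : 0 < b) (hb' : b ≠ 1) {k : ZMod n}
    (hk : 1 + b ≤ x k) : x (k + 1) ≤ 0 := by
  have h := (hx.reverse hb.ne' hb').one_add_le_of_nonpos hb (k := -k) (by simpa using hk)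
  have e : -(-k - 1) = k + 1 := by ring
  rw [e] at h
  linarith

theorem apply_ne_zero (hx : IsCycle b x) (hb : 0 < b) (hb' : b ≠ 1) (k : ZMod n) : x k ≠ 0 := by
  intro hk
  have h1 := hx.one_add_le_of_nonpos hb hk.le
  have h2 := (hx (k - 1)).2
  rw [sub_add_cancel, hk, zero_mul, eq_comm, mul_eq_zero] at h2
  have h3 := hx.nonpos_of_one_add_le hb hb' (k := k - 1 - 1)
    (by rcases h2 with h | h <;> linarith)
  rw [sub_add_cancel] at h3
  linarith

theorem apply_ne_one_add (hx : IsCycle b x) (hb : 0 < b) (hb' : b ≠ 1) (k : ZMod n) :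
    x k ≠ 1 + b := by
  have h := (hx.reverse hb.ne' hb').apply_ne_zero hb hb' (-k)
  rw [neg_neg] at h
  exact fun h' ↦ h (by rw [h', sub_self])

theorem neg_iff (hx : IsCycle b x) (hb : 0 < b) (hb' : b ≠ 1) {k : ZMod n} :
    x (k + 1) < 0 ↔ 1 + b < x k := by
  constructor
  · intro h
    have := hx.one_add_le_of_nonpos hb h.le
    rw [add_sub_cancel_right] at this
    exact this.lt_of_ne' (hx.apply_ne_one_add hb hb' k)
  · intro h
    exact (hx.nonpos_of_one_add_le hb hb' h.le).lt_of_ne (hx.apply_ne_zero hb hb' _)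

theorem not_neg_add_one (hx : IsCycle b x) (hb : 0 < b) (hb' : b ≠ 1) {k : ZMod n}
    (hk : x k < 0) : ¬ x (k + 1) < 0 := by
  rw [hx.neg_iff hb hb']
  linarith

theorem div_pos_of_not_neg (hx : IsCycle b x) (hb : 0 < b) (hb' : b ≠ 1) {k : ZMod n}
    (hk : ¬ x k < 0) (hk' : ¬ x (k + 1) < 0) : 0 < (x k - 1) / (b - x k) := by
  have hbk : b - x k ≠ 0 := sub_ne_zero.2 (hx.ne_param hb.ne' hb' k).symm
  have h1 : 0 < x (k + 1) := (not_lt.1 hk').lt_of_ne' (hx.apply_ne_zero hb hb' _)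
  have h2 : 0 < 1 + b - x (k - 1) := by
    have := (hx.neg_iff hb hb' (k := k - 1)).not.1 (by simpa using hk)
    have h3 := hx.apply_ne_one_add hb hb' (k - 1)
    have h4 := (not_lt.1 this).lt_of_ne h3
    linarith
  have e : (x k - 1) / (b - x k) = (1 + b - x (k - 1)) / x (k + 1) := by
    rw [div_eq_div_iff hbk h1.ne']
    linear_combination (hx k).2
  rw [e]
  positivity

theorem log_add_log (hx : IsCycle b x) (hb : 0 < b) (hb' : b ≠ 1) (k : ZMod n) :
    Real.log (x (k + 1)) + Real.log ((x k - 1) / (b - x k)) = Real.log (1 + b - x (k - 1)) := by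
  have hbk : b - x k ≠ 0 := sub_ne_zero.2 (hx.ne_param hb.ne' hb' k).symm
  rw [← Real.log_mul (hx.apply_ne_zero hb hb' _) (div_ne_zero (sub_ne_zero.2 (hx k).1) hbk)]
  congr 1
  field_simp
  linear_combination (hx k).2

end IsCycle

section LogSites

variable {b : ℝ}

theorem log_sites_of_neg {x : ℝ} (hb : 0 < b) (hx : x < 0) :
    Real.log ((x - 1) / (b - x)) = Real.log (1 + -x) - Real.log (b + -x) ∧
      Real.log x = Real.log (-x) ∧ Real.log (1 + b - x) = Real.log (1 + b + -x) := by
  refine ⟨?_, (Real.log_neg_eq_log x).symm, rfl⟩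
  rw [← Real.log_div (by linarith) (by linarith), ← Real.log_neg_eq_log]
  congr 1
  have : b + -x ≠ 0 := by linarith
  have : b - x ≠ 0 := by linarith
  field_simp
  ring

theorem log_sites_of_one_add_lt {x : ℝ} (hb : 0 < b) (hx : 1 + b < x) :
    Real.log ((x - 1) / (b - x)) =
        Real.log (b + (x - 1 - b)) - Real.log (1 + (x - 1 - b)) ∧
      Real.log x = Real.log (1 + b + (x - 1 - b)) ∧
      Real.log (1 + b - x) = Real.log (x - 1 - b) := by
  refine ⟨?_, by ring_nf, ?_⟩
  · rw [← Real.log_div (by linarith) (by linarith), ← Real.log_neg_eq_log]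
    congr 1
    have : 1 + (x - 1 - b) ≠ 0 := by linarith
    have : b - x ≠ 0 := by linarith
    field_simp
    ring
  · rw [← Real.log_neg_eq_log]
    ring_nf

theorem sites_of_div_pos {x T : ℝ} (hx : b - x ≠ 0) (hT : T = (x - 1) / (b - x)) (hT0 : 0 < T) :
    x = (1 + b * T) / (1 + T) ∧ 1 + b - x = (b + T) / (1 + T) := by
  have h1 : (1 + T) ≠ 0 := by positivity
  rw [eq_div_iff hx] at hT
  constructor
  · rw [eq_div_iff h1]
    linarith
  · rw [eq_div_iff h1]
    linarith

theorem log_gap {t : ℝ} (hb : 0 < b) (ht : 0 < t) :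
    0 < Real.log (1 + t) - Real.log (b + t) + Real.log (1 + b + t) - Real.log t := by
  have h1 : Real.log (b + t) < Real.log (1 + b + t) :=
    Real.log_lt_log (by linarith) (by linarith)
  have h2 : Real.log t < Real.log (1 + t) := Real.log_lt_log ht (by linarith)
  linarith

end LogSites

namespace IsCycle

variable {n : ℕ} [NeZero n] {b : ℝ} {x : ZMod n → ℝ}

theorem exists_not_neg (hx : IsCycle b x) (hb : 0 < b) (hb' : b ≠ 1) :
    ∃ k, ¬ x k < 0 ∧ ¬ x (k + 1) < 0 := by
  by_contra! hcon
  set ε : ZMod n → ℝ := fun k ↦ if x k < 0 then 1 else -1 with hε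
  have hε1 : ∀ k, ε (k + 1) = -ε k := fun k ↦ by
    by_cases hk : x k < 0
    · simp [hε, hk, hx.not_neg_add_one hb hb' hk]
    · simp [hε, hk, hcon k (not_lt.1 hk)]
  have hpos : 0 < ∑ k, ε k * (Real.log ((x k - 1) / (b - x k)) + Real.log (1 + b - x k) -
      Real.log (x k)) := by
    refine Finset.sum_pos (fun k _ ↦ ?_) Finset.univ_nonempty
    by_cases hk : x k < 0
    · obtain ⟨e1, e2, e3⟩ := log_sites_of_neg hb hk
      simp only [hε, if_pos hk]
      rw [e1, e2, e3]
      linarith [log_gap hb (neg_pos.2 hk)]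
    · have hk' := (hx.neg_iff hb hb').1 (hcon k (not_lt.1 hk))
      obtain ⟨e1, e2, e3⟩ := log_sites_of_one_add_lt hb hk'
      simp only [hε, if_neg hk]
      rw [e1, e2, e3]
      linarith [log_gap hb (show 0 < x k - 1 - b by linarith)]
  have e1 : ∑ k, ε k * Real.log (1 + b - x k) = ∑ k, -(ε k * Real.log (1 + b - x (k - 1))) := by
    rw [← ZMod.sum_sub_one]
    refine Finset.sum_congr rfl fun k _ ↦ ?_
    have := hε1 (k - 1)
    rw [sub_add_cancel] at this
    rw [this]
    ring
  have e2 : ∑ k, ε k * Real.log (x k) = ∑ k, -(ε k * Real.log (x (k + 1))) := by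
    rw [← ZMod.sum_add_one]
    refine Finset.sum_congr rfl fun k _ ↦ ?_
    rw [hε1]
    ring
  simp only [mul_sub, mul_add, Finset.sum_sub_distrib, Finset.sum_add_distrib] at hpos
  rw [e1, e2, ← Finset.sum_add_distrib, ← Finset.sum_sub_distrib] at hpos
  refine hpos.ne' (Finset.sum_eq_zero fun k _ ↦ ?_)
  linear_combination ε k * hx.log_add_log hb hb' k

/-- Two real cycles with the same sign pattern agree. -/
theorem eq_of_neg_iff {x' : ZMod n → ℝ} (hx : IsCycle b x) (hx' : IsCycle b x') (hb : 0 < b)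
    (hb' : b ≠ 1) (h : ∀ k, x k < 0 ↔ x' k < 0) : x = x' := by
  classical
  set dX : ZMod n → ℝ := fun k ↦ Real.log (x' k) - Real.log (x k) with hdX
  set dY : ZMod n → ℝ := fun k ↦ Real.log (1 + b - x' k) - Real.log (1 + b - x k) with hdY
  set dT : ZMod n → ℝ := fun k ↦ Real.log ((x' k - 1) / (b - x' k)) -
    Real.log ((x k - 1) / (b - x k)) with hdT
  have hrel : ∀ k, dX (k + 1) + dT k = dY (k - 1) := fun k ↦ by
    have h1 := hx.log_add_log hb hb' k
    have h2 := hx'.log_add_log hb hb' k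
    simp only [hdX, hdY, hdT]
    linarith
  set α : ZMod n → ℝ := fun k ↦ if x k < 0 then -1 else 1 with hα
  set γ : ZMod n → ℝ := fun k ↦ if x (k + 1) < 0 then -1 else 1 with hγ
  set τ : ZMod n → ℝ := fun k ↦ if x k < 0 ∨ x (k + 1) < 0 then 1 else -1 with hτ
  have hγα : ∀ k, γ (k - 1) = α k := fun k ↦ by simp [hγ, hα]
  have htri : ∀ k, 0 ≤ τ k * |dT k| + α (k + 1) * |dX (k + 1)| + γ (k - 1) * |dY (k - 1)| := by
    intro k
    rw [hγα, ← hrel k]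
    have t1 := abs_add_le (dX (k + 1)) (dT k)
    have t2 := abs_sub (dX (k + 1) + dT k) (dT k)
    have t3 := abs_sub (dX (k + 1) + dT k) (dX (k + 1))
    rw [add_sub_cancel_right] at t2
    rw [add_sub_cancel_left] at t3
    by_cases h1 : x k < 0
    · have h2 := hx.not_neg_add_one hb hb' h1
      simp only [hα, hτ, h1, h2, if_true, if_false, true_or]
      linarith
    · by_cases h2 : x (k + 1) < 0
      · simp only [hα, hτ, h1, h2, if_true, if_false, or_true]
        linarith
      · simp only [hα, hτ, h1, h2, if_false, or_self]
        linarith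
  have hsite : ∀ k, x k ≠ x' k → τ k * |dT k| + α k * |dX k| + γ k * |dY k| < 0 := by
    intro k hk
    simp only [hdT, hdX, hdY]
    by_cases h1 : x k < 0
    · have h2 := hx.not_neg_add_one hb hb' h1
      have h1' := (h k).1 h1
      simp only [hα, hτ, hγ, h1, h2, if_true, if_false, true_or]
      obtain ⟨e1, e2, e3⟩ := log_sites_of_neg hb h1
      obtain ⟨e1', e2', e3'⟩ := log_sites_of_neg hb h1'
      have := abs_log_ratio_add_abs_log_lt hb (neg_pos.2 h1) (neg_pos.2 h1')
        (neg_injective.ne hk)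
      rw [e1, e2, e3, e1', e2', e3']
      linarith
    · by_cases h2 : x (k + 1) < 0
      · have h3 := (hx.neg_iff hb hb').1 h2
        have h3' := (hx'.neg_iff hb hb').1 ((h (k + 1)).1 h2)
        simp only [hα, hτ, hγ, h1, h2, if_true, if_false, or_true]
        obtain ⟨e1, e2, e3⟩ := log_sites_of_one_add_lt hb h3
        obtain ⟨e1', e2', e3'⟩ := log_sites_of_one_add_lt hb h3'
        have := abs_log_ratio_add_abs_log_lt hb (t := x k - 1 - b) (t' := x' k - 1 - b)
          (by linarith) (by linarith) (fun e ↦ hk (by linarith))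
        rw [abs_sub_comm] at this
        have e4 : ∀ p q r s : ℝ, p - q - (r - s) = s - r - (q - p) := fun p q r s ↦ by ring
        rw [e4] at this
        rw [e1, e2, e3, e1', e2', e3']
        linarith
      · simp only [hα, hτ, hγ, h1, h2, if_false, or_self]
        have hT := hx.div_pos_of_not_neg hb hb' h1 h2
        have hT' := hx'.div_pos_of_not_neg hb hb' (mt (h k).2 h1) (mt (h (k + 1)).2 h2)
        obtain ⟨e1, e2⟩ := sites_of_div_pos
          (sub_ne_zero.2 (hx.ne_param hb.ne' hb' k).symm) rfl hT
        obtain ⟨e1', e2'⟩ := sites_of_div_pos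
          (sub_ne_zero.2 (hx'.ne_param hb.ne' hb' k).symm) rfl hT'
        have hne : (x k - 1) / (b - x k) ≠ (x' k - 1) / (b - x' k) := fun e ↦
          hk (by rw [e1, e, ← e1'])
        have := abs_log_add_abs_log_lt hb hT hT' hne
        rw [← e1, ← e2, ← e1', ← e2'] at this
        linarith
  funext k
  by_contra hk
  have hneg : ∑ k, (τ k * |dT k| + α k * |dX k| + γ k * |dY k|) < 0 := by
    refine Finset.sum_neg' (fun j _ ↦ ?_) ⟨k, Finset.mem_univ k, hsite k hk⟩
    by_cases hj : x j = x' j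
    · simp [hdT, hdX, hdY, hj]
    · exact (hsite j hj).le
  have hnonneg := Finset.sum_nonneg fun k (_ : k ∈ Finset.univ) ↦ htri k
  simp only [Finset.sum_add_distrib] at hneg hnonneg
  rw [ZMod.sum_add_one fun k ↦ α k * |dX k|, ZMod.sum_sub_one fun k ↦ γ k * |dY k|] at hnonneg
  linarith

end IsCycle

namespace SignPattern

variable {n : ℕ} (b : ℝ) (w : ZMod n → Prop) [DecidablePred w]

/-- `log |x k|` as a function of the logarithm of the leading quantity at `k`. -/
noncomputable def logX (k : ZMod n) (u : ℝ) : ℝ :=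
  if w k then u else if w (k + 1) then Real.log (1 + b + Real.exp u)
  else Real.log ((1 + b * Real.exp u) / (1 + Real.exp u))

/-- `log |1 + b - x k|` as a function of the logarithm of the leading quantity at `k`. -/
noncomputable def logY (k : ZMod n) (u : ℝ) : ℝ :=
  if w k then Real.log (1 + b + Real.exp u) else if w (k + 1) then u
  else Real.log ((b + Real.exp u) / (1 + Real.exp u))

/-- `log |(x k - 1) / (b - x k)|` as a function of the logarithm of the leading quantity at `k`. -/
noncomputable def logT (k : ZMod n) (u : ℝ) : ℝ :=
  if w k then Real.log (1 + Real.exp u) - Real.log (b + Real.exp u)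
  else if w (k + 1) then Real.log (b + Real.exp u) - Real.log (1 + Real.exp u) else u

/-- The leading quantity in the equation at `j`, expressed through the other two. -/
noncomputable def solveAt (u : ZMod n → ℝ) (j : ZMod n) : ℝ :=
  if w j then logX b w (j + 1) (u (j + 1)) + logT b w j (u j)
  else if w (j + 1) then logY b w (j - 1) (u (j - 1)) - logT b w j (u j)
  else logY b w (j - 1) (u (j - 1)) - logX b w (j + 1) (u (j + 1))

/-- The site whose leading quantity is the leading quantity in the equation at `j`. -/
def lead (j : ZMod n) : ZMod n := if w j then j - 1 else if w (j + 1) then j + 1 else j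

variable {b w}

theorem lead_involutive (hw : ∀ k, w k → ¬ w (k + 1)) : Function.Involutive (lead w) := by
  intro j
  have hw' : ∀ k, w k → ¬ w (k - 1) := fun k hk hk' ↦ hw _ hk' (by simpa using hk)
  by_cases h1 : w j
  · simp [lead, h1, hw' j h1]
  · by_cases h2 : w (j + 1) <;> simp [lead, h1, h2]

theorem sum_lead [NeZero n] (hw : ∀ k, w k → ¬ w (k + 1)) (f : ZMod n → ℝ) :
    ∑ j, f (lead w j) = ∑ j, f j :=
  Equiv.sum_comp (lead_involutive hw).toPerm f

theorem sum_abs_solveAt_lt [NeZero n] (hb : 0 < b) (hw : ∀ k, w k → ¬ w (k + 1))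
    {u v : ZMod n → ℝ} (huv : u ≠ v) :
    ∑ j, |solveAt b w v j - solveAt b w u j| < ∑ j, |v j - u j| := by
  set dT : ZMod n → ℝ := fun k ↦
    if w k ∨ w (k + 1) then |logT b w k (v k) - logT b w k (u k)| else 0 with hdT
  set dX : ZMod n → ℝ := fun k ↦
    if w k then 0 else |logX b w k (v k) - logX b w k (u k)| with hdX
  set dY : ZMod n → ℝ := fun k ↦
    if w (k + 1) then 0 else |logY b w k (v k) - logY b w k (u k)| with hdY
  have hsite : ∀ k, u k ≠ v k → dT k + dX k + dY k < |v k - u k| := by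
    intro k hk
    have hexp : Real.exp (u k) ≠ Real.exp (v k) := fun h ↦ hk (Real.exp_injective h)
    have h1 := abs_log_ratio_add_abs_log_lt hb (Real.exp_pos (u k)) (Real.exp_pos (v k)) hexp
    have h2 := abs_log_add_abs_log_lt hb (Real.exp_pos (u k)) (Real.exp_pos (v k)) hexp
    rw [Real.log_exp, Real.log_exp] at h1 h2
    simp only [hdT, hdX, hdY, logX, logY, logT]
    by_cases hA : w k
    · simpa [hA, hw k hA] using h1
    · by_cases hC : w (k + 1)
      · rw [abs_sub_comm] at h1
        have e : ∀ p q r s : ℝ, p - q - (r - s) = s - r - (q - p) := fun p q r s ↦ by ring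
        rw [e] at h1
        simpa [hA, hC] using h1
      · simpa [hA, hC] using h2
  have hsite' : ∀ k, dT k + dX k + dY k ≤ |v k - u k| := by
    intro k
    by_cases hk : u k = v k
    · simp [hdT, hdX, hdY, hk]
    · exact (hsite k hk).le
  have heq : ∀ j, |solveAt b w v j - solveAt b w u j| ≤ dT j + dX (j + 1) + dY (j - 1) := by
    intro j
    simp only [solveAt, hdT, hdX, hdY, sub_add_cancel]
    by_cases hA : w j
    · simp only [hA, hw j hA, if_true, if_false, true_or, add_zero]
      rw [add_sub_add_comm, add_comm |logT b w j _ - _|]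
      exact abs_add_le _ _
    · by_cases hC : w (j + 1)
      · simp only [hA, hC, if_true, if_false, or_true, add_zero]
        rw [sub_sub_sub_comm, add_comm |logT b w j _ - _|]
        exact abs_sub _ _
      · simp only [hA, hC, if_false, or_self, zero_add]
        rw [sub_sub_sub_comm, add_comm |logX b w _ _ - _|]
        exact abs_sub _ _
  calc ∑ j, |solveAt b w v j - solveAt b w u j| ≤ ∑ j, (dT j + dX (j + 1) + dY (j - 1)) :=
        Finset.sum_le_sum fun j _ ↦ heq j
    _ = ∑ j, (dT j + dX j + dY j) := by
        simp only [Finset.sum_add_distrib, ZMod.sum_add_one dX, ZMod.sum_sub_one dY]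
    _ < ∑ j, |v j - u j| := by
        obtain ⟨k, hk⟩ := Function.ne_iff.1 huv
        exact Finset.sum_lt_sum (fun j _ ↦ hsite' j) ⟨k, Finset.mem_univ k, hsite k hk⟩

theorem continuous_solveAt (hb : 0 < b) (j : ZMod n) : Continuous fun u ↦ solveAt b w u j := by
  have hX : ∀ k, Continuous (logX b w k) := fun k ↦ by
    unfold logX
    split_ifs
    · fun_prop
    · exact Continuous.log (by fun_prop) fun u ↦ by positivity
    · exact Continuous.log (Continuous.div (by fun_prop) (by fun_prop) fun u ↦ by positivity)
        fun u ↦ by positivity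
  have hY : ∀ k, Continuous (logY b w k) := fun k ↦ by
    unfold logY
    split_ifs
    · exact Continuous.log (by fun_prop) fun u ↦ by positivity
    · fun_prop
    · exact Continuous.log (Continuous.div (by fun_prop) (by fun_prop) fun u ↦ by positivity)
        fun u ↦ by positivity
  have hT : ∀ k, Continuous (logT b w k) := fun k ↦ by
    have h1 : Continuous fun u ↦ Real.log (1 + Real.exp u) :=
      Continuous.log (by fun_prop) fun u ↦ by positivity
    have h2 : Continuous fun u ↦ Real.log (b + Real.exp u) :=
      Continuous.log (by fun_prop) fun u ↦ by positivity
    unfold logT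
    split_ifs <;> fun_prop
  unfold solveAt
  split_ifs <;> fun_prop

theorem abs_log_le_of_mem_uIcc {c r : ℝ} (hc : 0 < c) (hr : r ∈ Set.uIcc 1 c) :
    |Real.log r| ≤ |Real.log c| := by
  rcases Set.mem_uIcc.1 hr with ⟨h1, h2⟩ | ⟨h1, h2⟩
  · rw [abs_of_nonneg (Real.log_nonneg h1), abs_of_nonneg (Real.log_nonneg (h1.trans h2))]
    exact Real.log_le_log (by linarith) h2
  · rw [abs_of_nonpos (Real.log_nonpos (by linarith) h2),
      abs_of_nonpos (Real.log_nonpos hc.le (h1.trans h2))]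
    linarith [Real.log_le_log hc h1]

theorem abs_log_div_le {b s : ℝ} (hb : 0 < b) (hs : 0 < s) :
    |Real.log ((1 + b * s) / (1 + s))| ≤ |Real.log b| ∧
      |Real.log ((b + s) / (1 + s))| ≤ |Real.log b| := by
  have h : 0 < 1 + s := by linarith
  constructor <;> apply abs_log_le_of_mem_uIcc hb <;> rw [Set.mem_uIcc] <;>
    rcases le_total 1 b with h1 | h1
  · left; rw [le_div_iff₀ h, div_le_iff₀ h]; constructor <;> nlinarith
  · right; rw [le_div_iff₀ h, div_le_iff₀ h]; constructor <;> nlinarith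
  · left; rw [le_div_iff₀ h, div_le_iff₀ h]; constructor <;> nlinarith
  · right; rw [le_div_iff₀ h, div_le_iff₀ h]; constructor <;> nlinarith

theorem abs_log_one_add_add_exp_le (hb : 0 < b) (u : ℝ) :
    |Real.log (1 + b + Real.exp u)| ≤ Real.log (2 + b) + |u| := by
  have h0 := Real.exp_pos u
  rw [abs_of_nonneg (Real.log_nonneg (by linarith)), ← Real.log_exp |u|,
    ← Real.log_mul (by positivity) (by positivity)]
  apply Real.log_le_log (by positivity)
  have h1 : Real.exp u ≤ Real.exp |u| := Real.exp_le_exp.2 (le_abs_self u)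
  have h2 : 1 ≤ Real.exp |u| := Real.one_le_exp (abs_nonneg u)
  nlinarith

end SignPattern

theorem ZMod.val_sub_one_add_one {n : ℕ} [NeZero n] {z : ZMod n} (hz : z ≠ 0) :
    (z - 1).val + 1 = z.val := by
  have h1 : (((z - 1).val + 1 : ℕ) : ZMod n) = z := by simp
  rcases (Nat.succ_le_of_lt (ZMod.val_lt (z - 1))).lt_or_eq with h | h
  · rw [← ZMod.val_cast_of_lt (show (z - 1).val + 1 < n from h), h1]
  · rw [← Nat.succ_eq_add_one, h, ZMod.natCast_self] at h1
    exact (hz h1.symm).elim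

namespace SignPattern

variable {n : ℕ} {b : ℝ} {w : ZMod n → Prop} [DecidablePred w]

theorem abs_logT_le (hb : 0 < b) {k : ZMod n} (hk : w k ∨ w (k + 1)) (u : ℝ) :
    |logT b w k u| ≤ |Real.log b| := by
  have h := (abs_log_div_le hb (Real.exp_pos u)).2
  rw [Real.log_div (by positivity) (by positivity)] at h
  unfold logT
  split_ifs with h1 h2
  · rwa [abs_sub_comm]
  · exact h
  · tauto

theorem abs_logX_le_of_add_one (hb : 0 < b) {k : ZMod n} (hk : ¬ w k) (hk' : w (k + 1)) (u : ℝ) :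
    |logX b w k u| ≤ Real.log (2 + b) + |u| := by
  simpa [logX, hk, hk'] using abs_log_one_add_add_exp_le hb u

theorem abs_logY_le_of_self (hb : 0 < b) {k : ZMod n} (hk : w k) (u : ℝ) :
    |logY b w k u| ≤ Real.log (2 + b) + |u| := by
  simpa [logY, hk] using abs_log_one_add_add_exp_le hb u

theorem abs_logX_le_of_not (hb : 0 < b) {k : ZMod n} (hk : ¬ w k) (hk' : ¬ w (k + 1)) (u : ℝ) :
    |logX b w k u| ≤ |Real.log b| := by
  simpa [logX, hk, hk'] using (abs_log_div_le hb (Real.exp_pos u)).1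

theorem abs_logY_le_of_not (hb : 0 < b) {k : ZMod n} (hk : ¬ w k) (hk' : ¬ w (k + 1)) (u : ℝ) :
    |logY b w k u| ≤ |Real.log b| := by
  simpa [logY, hk, hk'] using (abs_log_div_le hb (Real.exp_pos u)).2

variable (b w) in
/-- A bound for the logarithm of the leading quantity at `k`, growing with the distance of `k`
from `k₀` (on one side or the other) when a negative factor is present at `k`. -/
noncomputable def bound (k₀ k : ZMod n) : ℝ :=
  (|Real.log b| + Real.log (2 + b)) *
    if w k then ((k - k₀).val + 1 : ℝ) else if w (k + 1) then (k₀ - k).val + 1 else 2 * n + 2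

theorem abs_solveAt_le [NeZero n] (hb : 0 < b) (hw : ∀ k, w k → ¬ w (k + 1)) {k₀ : ZMod n}
    (h₀ : ¬ w k₀) (h₀' : ¬ w (k₀ + 1)) {u : ZMod n → ℝ} (hu : ∀ k, |u k| ≤ bound b w k₀ k)
    (j : ZMod n) : |solveAt b w u j| ≤ bound b w k₀ (lead w j) := by
  have hc1 : 0 ≤ |Real.log b| := abs_nonneg _
  have hc2 : 0 ≤ Real.log (2 + b) := Real.log_nonneg (by linarith)
  have hw' : ∀ k, w k → ¬ w (k - 1) := fun k hk hk' ↦ hw _ hk' (by simpa using hk)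
  have hlt : ∀ z : ZMod n, (z.val : ℝ) + 1 ≤ n := fun z ↦ by exact_mod_cast ZMod.val_lt z
  by_cases hA : w j
  · have hv : ((k₀ - (j - 1)).val : ℝ) = (k₀ - (j + 1)).val + 2 := by
      have h1 : k₀ - (j - 1) ≠ 0 := fun h ↦ h₀' (by
        rw [sub_eq_zero.1 h]; simpa using hA)
      have h2 : k₀ - j ≠ 0 := fun h ↦ h₀ (by rw [sub_eq_zero.1 h]; exact hA)
      have e1 := ZMod.val_sub_one_add_one h1
      have e2 := ZMod.val_sub_one_add_one h2
      rw [show k₀ - (j - 1) - 1 = k₀ - j by ring] at e1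
      rw [show k₀ - j - 1 = k₀ - (j + 1) by ring] at e2
      rw [← e1, ← e2]
      push_cast
      ring
    have hT := abs_logT_le hb (Or.inl hA) (u j)
    have hadd := abs_add_le (logX b w (j + 1) (u (j + 1))) (logT b w j (u j))
    simp only [solveAt, lead, bound, hA, hw' j hA, if_true, if_false, sub_add_cancel]
    rw [hv]
    have hv0 : (0 : ℝ) ≤ (k₀ - (j + 1)).val := Nat.cast_nonneg _
    by_cases hC : w (j + 1 + 1)
    · have hX := abs_logX_le_of_add_one hb (hw j hA) hC (u (j + 1))
      have hj := hu (j + 1)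
      simp only [bound, hw j hA, hC, if_true, if_false] at hj
      nlinarith
    · have hX := abs_logX_le_of_not hb (hw j hA) hC (u (j + 1))
      nlinarith
  by_cases hC : w (j + 1)
  · have hv : ((j + 1 - k₀).val : ℝ) = (j - 1 - k₀).val + 2 := by
      have h1 : j + 1 - k₀ ≠ 0 := fun h ↦ h₀ (by rw [← sub_eq_zero.1 h]; exact hC)
      have h2 : j - k₀ ≠ 0 := fun h ↦ h₀' (by rw [← sub_eq_zero.1 h]; exact hC)
      have e1 := ZMod.val_sub_one_add_one h1
      have e2 := ZMod.val_sub_one_add_one h2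
      rw [show j + 1 - k₀ - 1 = j - k₀ by ring] at e1
      rw [show j - k₀ - 1 = j - 1 - k₀ by ring] at e2
      rw [← e1, ← e2]
      push_cast
      ring
    have hT := abs_logT_le hb (Or.inr hC) (u j)
    have hadd := abs_sub (logY b w (j - 1) (u (j - 1))) (logT b w j (u j))
    simp only [solveAt, lead, bound, hA, hC, if_true, if_false]
    rw [hv]
    have hv0 : (0 : ℝ) ≤ (j - 1 - k₀).val := Nat.cast_nonneg _
    by_cases hA' : w (j - 1)
    · have hY := abs_logY_le_of_self hb hA' (u (j - 1))
      have hj := hu (j - 1)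
      simp only [bound, hA', if_true] at hj
      nlinarith
    · have hY := abs_logY_le_of_not hb hA' (by simpa using hA) (u (j - 1))
      nlinarith
  · have hadd := abs_sub (logY b w (j - 1) (u (j - 1))) (logX b w (j + 1) (u (j + 1)))
    simp only [solveAt, lead, bound, hA, hC, if_false]
    have hn : (0 : ℝ) ≤ n := Nat.cast_nonneg _
    have hX : |logX b w (j + 1) (u (j + 1))| ≤
        (|Real.log b| + Real.log (2 + b)) * (n + 1) := by
      by_cases hC' : w (j + 1 + 1)
      · have hX := abs_logX_le_of_add_one hb hC hC' (u (j + 1))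
        have hj := hu (j + 1)
        simp only [bound, hC, hC', if_true, if_false] at hj
        nlinarith [hlt (k₀ - (j + 1))]
      · have hX := abs_logX_le_of_not hb hC hC' (u (j + 1))
        nlinarith
    have hY : |logY b w (j - 1) (u (j - 1))| ≤
        (|Real.log b| + Real.log (2 + b)) * (n + 1) := by
      by_cases hA' : w (j - 1)
      · have hY := abs_logY_le_of_self hb hA' (u (j - 1))
        have hj := hu (j - 1)
        simp only [bound, hA', if_true] at hj
        nlinarith [hlt (j - 1 - k₀)]
      · have hY := abs_logY_le_of_not hb hA' (by simpa using hA) (u (j - 1))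
        nlinarith
    linarith

theorem exists_fixed [NeZero n] (hb : 0 < b) (hw : ∀ k, w k → ¬ w (k + 1)) {k₀ : ZMod n}
    (h₀ : ¬ w k₀) (h₀' : ¬ w (k₀ + 1)) :
    ∃ u : ZMod n → ℝ, ∀ j, solveAt b w u j = u (lead w j) := by
  set K : Set (ZMod n → ℝ) :=
    Set.univ.pi fun k ↦ Set.Icc (-bound b w k₀ k) (bound b w k₀ k) with hK
  have hKmem : ∀ u, u ∈ K ↔ ∀ k, |u k| ≤ bound b w k₀ k := fun u ↦ by
    simp only [hK, Set.mem_univ_pi, Set.mem_Icc, abs_le]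
  have hcomp : IsCompact K := isCompact_univ_pi fun k ↦ isCompact_Icc
  have hbound : ∀ k, 0 ≤ bound b w k₀ k := fun k ↦ by
    have hc2 : 0 ≤ Real.log (2 + b) := Real.log_nonneg (by linarith)
    unfold bound
    split_ifs <;> positivity
  have hne : K.Nonempty := ⟨0, (hKmem 0).2 fun k ↦ by simpa using hbound k⟩
  set G : (ZMod n → ℝ) → ZMod n → ℝ := fun u k ↦ solveAt b w u (lead w k) with hG
  have hGK : ∀ u ∈ K, G u ∈ K := fun u hu ↦ (hKmem _).2 fun k ↦ by
    have h := abs_solveAt_le hb hw h₀ h₀' ((hKmem u).1 hu) (lead w k)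
    rwa [lead_involutive hw k] at h
  have hcont : Continuous fun u ↦ ∑ k, |G u k - u k| := by
    refine continuous_finsetSum _ fun k _ ↦ Continuous.abs (Continuous.sub ?_ (by fun_prop))
    exact continuous_solveAt hb _
  obtain ⟨u, huK, hmin⟩ := hcomp.exists_isMinOn hne hcont.continuousOn
  refine ⟨u, fun j ↦ ?_⟩
  suffices h : G u = u by
    have := congrFun h (lead w j)
    simpa only [hG, lead_involutive hw j] using this
  by_contra h
  have h1 := hmin (hGK u huK)
  have h2 := sum_abs_solveAt_lt hb hw (Ne.symm h)
  rw [← sum_lead hw fun j ↦ |solveAt b w (G u) j - solveAt b w u j|] at h2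
  exact h2.not_ge h1

/-- Every admissible sign pattern is realised by a real cycle. -/
theorem exists_isCycle [NeZero n] (hb : 0 < b) (hb' : b ≠ 1) (hw : ∀ k, w k → ¬ w (k + 1))
    {k₀ : ZMod n} (h₀ : ¬ w k₀) (h₀' : ¬ w (k₀ + 1)) :
    ∃ x : ZMod n → ℝ, IsCycle b x ∧ ∀ k, x k < 0 ↔ w k := by
  obtain ⟨u, hu⟩ := exists_fixed hb hw h₀ h₀'
  have hw' : ∀ k, w k → ¬ w (k - 1) := fun k hk hk' ↦ hw _ hk' (by simpa using hk)
  have heq : ∀ j, logX b w (j + 1) (u (j + 1)) + logT b w j (u j) =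
      logY b w (j - 1) (u (j - 1)) := fun j ↦ by
    have h := hu j
    by_cases hA : w j
    · simp only [solveAt, lead, hA, if_true] at h
      simpa [logY, hA, hw' j hA] using h
    · by_cases hC : w (j + 1)
      · simp only [solveAt, lead, hA, hC, if_true, if_false] at h
        have e : logX b w (j + 1) (u (j + 1)) = u (j + 1) := by simp [logX, hC]
        linarith
      · simp only [solveAt, lead, hA, hC, if_false] at h
        have e : logT b w j (u j) = u j := by simp [logT, hA, hC]
        linarith
  set x : ZMod n → ℝ := fun k ↦ if w k then -Real.exp (u k) else
    if w (k + 1) then 1 + b + Real.exp (u k)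
    else (1 + b * Real.exp (u k)) / (1 + Real.exp (u k)) with hx
  set ε : ZMod n → ℝ := fun k ↦ if w k then -1 else 1 with hε
  have hexp : ∀ k, 0 < Real.exp (u k) := fun k ↦ Real.exp_pos _
  have hX : ∀ k, x k = ε k * Real.exp (logX b w k (u k)) := fun k ↦ by
    have := hexp k
    by_cases hA : w k
    · simp [hx, hε, logX, hA]
    · by_cases hC : w (k + 1)
      · simp only [hx, hε, logX, hA, hC, if_true, if_false]
        rw [Real.exp_log (by positivity), one_mul]
      · simp only [hx, hε, logX, hA, hC, if_false]
        rw [Real.exp_log (by positivity), one_mul]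
  have hY : ∀ k, 1 + b - x k = ε (k + 1) * Real.exp (logY b w k (u k)) := fun k ↦ by
    have := hexp k
    by_cases hA : w k
    · simp only [hx, hε, logY, hA, hw k hA, if_true, if_false]
      rw [Real.exp_log (by positivity), one_mul]
      ring
    · by_cases hC : w (k + 1)
      · simp [hx, hε, logY, hA, hC]
      · simp only [hx, hε, logY, hA, hC, if_false]
        rw [Real.exp_log (by positivity), one_mul]
        field_simp
        ring
  have hT : ∀ k, x k - 1 = ε (k + 1) * ε k * Real.exp (logT b w k (u k)) * (b - x k) := fun k ↦ by
    have := hexp k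
    by_cases hA : w k
    · simp only [hx, hε, logT, hA, hw k hA, if_true, if_false]
      rw [Real.exp_sub, Real.exp_log (by positivity), Real.exp_log (by positivity)]
      field_simp
      ring
    · by_cases hC : w (k + 1)
      · simp only [hx, hε, logT, hA, hC, if_true, if_false]
        rw [Real.exp_sub, Real.exp_log (by positivity), Real.exp_log (by positivity)]
        field_simp
        ring
      · simp only [hx, hε, logT, hA, hC, if_false]
        field_simp
        ring
  have hε2 : ∀ k, ε k * ε k = 1 := fun k ↦ by
    simp only [hε]
    split_ifs <;> norm_num
  refine ⟨x, fun k ↦ ⟨?_, ?_⟩, fun k ↦ ?_⟩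
  · have := hexp k
    simp only [hx]
    split_ifs with hA hC
    · linarith
    · linarith
    · rw [Ne, div_eq_one_iff_eq (by positivity)]
      intro h
      have h1 : (b - 1) * Real.exp (u k) = 0 := by linarith
      exact (mul_ne_zero (sub_ne_zero.2 hb') this.ne') h1
  · rw [hY (k - 1), sub_add_cancel, ← heq k, hT k, hX (k + 1), Real.exp_add]
    linear_combination ε k * Real.exp (logX b w (k + 1) (u (k + 1))) *
      Real.exp (logT b w k (u k)) * (b - x k) * hε2 (k + 1)
  · rw [hX k]
    have h := Real.exp_pos (logX b w k (u k))
    by_cases hA : w k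
    · simp [hε, hA, h]
    · simp [hε, hA, h.le]

end SignPattern

namespace GoldenWord

/-- No two consecutive letters of the word are both `true`. -/
def IsSparse {m : ℕ} (w : Fin (m + 1) → Bool) : Prop :=
  ∀ i : Fin m, ¬ (w i.castSucc = true ∧ w i.succ = true)

instance {m : ℕ} : DecidablePred (IsSparse (m := m)) := fun _ ↦ Fintype.decidableForallFintype

/-- Sparse words of length `m + 1` with prescribed first and last letters. -/
def sparseWords (m : ℕ) (i j : Bool) : Finset (Fin (m + 1) → Bool) :=
  {w | IsSparse w ∧ w 0 = i ∧ w (Fin.last m) = j}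

theorem isSparse_cons {m : ℕ} {i : Bool} {w : Fin (m + 1) → Bool} :
    IsSparse (Fin.cons i w : Fin (m + 2) → Bool) ↔ ¬ (i = true ∧ w 0 = true) ∧ IsSparse w := by
  unfold IsSparse
  rw [Fin.forall_fin_succ]
  simp

theorem sparseWords_succ_true (m : ℕ) (j : Bool) :
    sparseWords (m + 1) true j = (sparseWords m false j).image (Fin.cons true) := by
  ext w
  obtain ⟨i, w, rfl⟩ : ∃ i v, w = (Fin.cons i v : Fin (m + 2) → Bool) :=
    ⟨w 0, Fin.tail w, (Fin.cons_self_tail w).symm⟩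
  simp [sparseWords, isSparse_cons, ← Fin.succ_last, Fin.cons_inj]
  grind

theorem sparseWords_succ_false (m : ℕ) (j : Bool) :
    sparseWords (m + 1) false j =
      (sparseWords m false j ∪ sparseWords m true j).image (Fin.cons false) := by
  ext w
  obtain ⟨i, w, rfl⟩ : ∃ i v, w = (Fin.cons i v : Fin (m + 2) → Bool) :=
    ⟨w 0, Fin.tail w, (Fin.cons_self_tail w).symm⟩
  simp [sparseWords, isSparse_cons, ← Fin.succ_last, Fin.cons_inj]
  grind

theorem card_sparseWords_succ_true (m : ℕ) (j : Bool) :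
    (sparseWords (m + 1) true j).card = (sparseWords m false j).card := by
  rw [sparseWords_succ_true, Finset.card_image_of_injective _ (Fin.cons_right_injective _)]

theorem card_sparseWords_succ_false (m : ℕ) (j : Bool) :
    (sparseWords (m + 1) false j).card =
      (sparseWords m false j).card + (sparseWords m true j).card := by
  rw [sparseWords_succ_false, Finset.card_image_of_injective _ (Fin.cons_right_injective _),
    Finset.card_union_of_disjoint]
  rw [Finset.disjoint_left]
  simp +contextual [sparseWords]

theorem card_sparseWords (m : ℕ) :
    (sparseWords m false false).card = Nat.fib (m + 1) ∧
      (sparseWords m true false).card = Nat.fib m ∧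
      (sparseWords m false true).card = Nat.fib m ∧
      (sparseWords (m + 1) false true).card = Nat.fib (m + 1) := by
  induction m with
  | zero => decide
  | succ m ih =>
    obtain ⟨h1, h2, h3, h4⟩ := ih
    refine ⟨?_, ?_, h4, ?_⟩
    · rw [card_sparseWords_succ_false, h1, h2, Nat.fib_add_two, add_comm]
    · rw [card_sparseWords_succ_true, h1]
    · rw [card_sparseWords_succ_false, card_sparseWords_succ_true, h4, h3, Nat.fib_add_two,
        add_comm]

variable (n : ℕ) [NeZero n]

/-- Cyclic words without two cyclically consecutive letters `true`. -/
def cyclicSparse : Finset (ZMod n → Bool) := {w | ∀ k, ¬ (w k = true ∧ w (k + 1) = true)}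

/-- Cyclic words whose letters alternate. -/
def alternating : Finset (ZMod n → Bool) := {w | ∀ k, w (k + 1) = !w k}

theorem card_cyclicSparse_fin (m : ℕ) :
    ({w : Fin (m + 1) → Bool | ∀ k, ¬ (w k = true ∧ w (k + 1) = true)} : Finset _).card =
      Nat.fib (m + 2) + Nat.fib m := by
  have e : ({w : Fin (m + 1) → Bool | ∀ k, ¬ (w k = true ∧ w (k + 1) = true)} : Finset _) =
      sparseWords m false false ∪ sparseWords m true false ∪ sparseWords m false true := by
    ext w
    have h : (∀ k : Fin (m + 1), ¬ (w k = true ∧ w (k + 1) = true)) ↔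
        IsSparse w ∧ ¬ (w (Fin.last m) = true ∧ w 0 = true) := by
      rw [Fin.forall_fin_succ']
      simp only [IsSparse, Fin.coeSucc_eq_succ, Fin.last_add_one]
    simp only [sparseWords, Finset.mem_union, Finset.mem_filter, Finset.mem_univ, true_and, h]
    cases w 0 <;> cases w (Fin.last m) <;> simp
  obtain ⟨h1, h2, h3, -⟩ := card_sparseWords m
  rw [e, Finset.card_union_of_disjoint, Finset.card_union_of_disjoint, h1, h2, h3,
    Nat.fib_add_two]
  · ring
  · rw [Finset.disjoint_left]
    simp +contextual [sparseWords]
  · rw [Finset.disjoint_left]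
    simp only [sparseWords, Finset.mem_union, Finset.mem_filter, Finset.mem_univ, true_and]
    grind

theorem card_cyclicSparse : (cyclicSparse n).card = Nat.fib (n + 1) + Nat.fib (n - 1) := by
  obtain ⟨m, rfl⟩ : ∃ m, n = m + 1 := ⟨n - 1, (Nat.succ_pred (NeZero.ne n)).symm⟩
  rw [Nat.add_sub_cancel, ← card_cyclicSparse_fin]
  let e := ZMod.finEquiv (m + 1)
  refine Finset.card_equiv (e.symm.toEquiv.arrowCongr (Equiv.refl Bool)) fun w ↦ ?_
  simp only [cyclicSparse, Finset.mem_filter, Finset.mem_univ, true_and]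
  rw [← e.toEquiv.forall_congr_right]
  simp [Equiv.arrowCongr, e]

theorem card_alternating : (alternating n).card = if Odd n then 0 else 2 := by
  split_ifs with hn
  · rw [Finset.card_eq_zero, Finset.eq_empty_iff_forall_notMem]
    intro w hw
    simp only [alternating, Finset.mem_filter, Finset.mem_univ, true_and] at hw
    have key : ∀ m : ℕ, w m = if Odd m then !w 0 else w 0 := by
      intro m
      induction m with
      | zero => simp
      | succ m ih =>
        rw [Nat.cast_succ, hw, ih]
        by_cases hm : Odd m <;> simp [hm, Nat.odd_add_one]
    have := key n
    simp [hn] at this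
  · have h2 : 2 ∣ n := (Nat.not_odd_iff_even.1 hn).two_dvd
    set w₀ : ZMod n → Bool := fun k ↦ decide (ZMod.castHom h2 (ZMod 2) k = 0) with hw₀
    have hstep : ∀ k, w₀ (k + 1) = !w₀ k := fun k ↦ by
      simp only [hw₀, map_add, map_one]
      generalize ZMod.castHom h2 (ZMod 2) k = z
      revert z
      decide
    have e : alternating n = {w₀, fun k ↦ !w₀ k} := by
      ext w
      simp only [alternating, Finset.mem_filter, Finset.mem_univ, true_and, Finset.mem_insert,
        Finset.mem_singleton]
      constructor
      · intro hw
        by_cases h0 : w 0 = w₀ 0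
        · left
          funext k
          exact ZMod.forall_of_forall_add_one (P := fun k ↦ w k = w₀ k) h0
            (fun k hk ↦ by rw [hw, hstep, hk]) k
        · right
          funext k
          exact ZMod.forall_of_forall_add_one (P := fun k ↦ w k = !w₀ k) (k₀ := 0)
            (by revert h0; cases w 0 <;> cases w₀ 0 <;> simp) (fun k hk ↦ by rw [hw, hstep, hk]) k
      · rintro (rfl | rfl) k
        · exact hstep k
        · change (!w₀ (k + 1)) = !!w₀ k
          rw [hstep]
    rw [e, Finset.card_pair]
    intro h
    simpa using congrFun h 0

/-- Cyclically sparse words with two cyclically consecutive letters `false`. -/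
def admissible : Finset (ZMod n → Bool) :=
  {w | (∀ k, ¬ (w k = true ∧ w (k + 1) = true)) ∧ ∃ k, ¬ w k = true ∧ ¬ w (k + 1) = true}

theorem card_admissible : (admissible n).card =
    if Odd n then Nat.fib (n + 1) + Nat.fib (n - 1)
    else Nat.fib (n + 1) + Nat.fib (n - 1) - 2 := by
  have e : admissible n = cyclicSparse n \ alternating n := by
    ext w
    simp only [admissible, cyclicSparse, alternating, Finset.mem_sdiff, Finset.mem_filter,
      Finset.mem_univ, true_and, not_forall]
    refine and_congr_right fun h ↦ exists_congr fun k ↦ ?_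
    have := h k
    revert this
    cases w k <;> cases w (k + 1) <;> simp
  have hsub : alternating n ⊆ cyclicSparse n := fun w hw ↦ by
    simp only [cyclicSparse, alternating, Finset.mem_filter, Finset.mem_univ, true_and] at hw ⊢
    intro k
    rw [hw k]
    cases w k <;> simp
  rw [e, Finset.card_sdiff_of_subset hsub, card_cyclicSparse, card_alternating]
  split_ifs <;> rfl

end GoldenWord

section Orbit

variable {n : ℕ} {a : ℝ}

theorem IsCycle.ofReal {b : ℝ} {x : ZMod n → ℝ} (hx : IsCycle b x) :
    IsCycle (b : ℂ) fun k ↦ (x k : ℂ) :=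
  fun k ↦ ⟨Complex.ofReal_ne_one.2 (hx k).1, by beta_reduce; exact_mod_cast (hx k).2⟩

variable [NeZero n]

theorem injOn_isCycle :
    Set.InjOn (fun x : ZMod n → ℂ ↦ (x 0, x (-1) + a - 1)) {x | IsCycle (-a : ℂ) x} := by
  intro x hx y hy hxy
  funext k
  have h1 := iterate_biratC_of_isCycle hx k.val
  have h2 := iterate_biratC_of_isCycle hy k.val
  simp only at hxy
  rw [hxy, h2] at h1
  simpa using (Prod.ext_iff.1 h1).1.symm

/-- The sign pattern of the real parts of a cyclic sequence. -/
noncomputable def signWord (x : ZMod n → ℂ) (k : ZMod n) : Bool := decide ((x k).re < 0)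

theorem IsCycle.re {b : ℝ} {x : ZMod n → ℂ} (hx : IsCycle (b : ℂ) x) (hb : 0 < b)
    (hb' : b ≠ 1) :
    IsCycle b (fun k ↦ (x k).re) := by
  have hre : ∀ k, x k = ((x k).re : ℂ) := fun k ↦
    Complex.ext rfl (by simpa using hx.im_eq_zero hb hb' k)
  intro k
  obtain ⟨h1, h2⟩ := hx k
  rw [hre k] at h1 h2
  rw [hre (k + 1), hre (k - 1)] at h2
  exact ⟨by exact_mod_cast h1, by exact_mod_cast h2⟩

theorem injOn_signWord {b : ℝ} (hb : 0 < b) (hb' : b ≠ 1) :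
    Set.InjOn (signWord (n := n)) {x | IsCycle (b : ℂ) x} := by
  intro x hx y hy hxy
  have h := (IsCycle.re hx hb hb').eq_of_neg_iff (IsCycle.re hy hb hb') hb hb' fun k ↦ by
    simpa [signWord] using congrFun hxy k
  funext k
  refine Complex.ext (congrFun h k) ?_
  rw [IsCycle.im_eq_zero hx hb hb', IsCycle.im_eq_zero hy hb hb']

theorem image_signWord {b : ℝ} (hb : 0 < b) (hb' : b ≠ 1) :
    signWord '' {x : ZMod n → ℂ | IsCycle (b : ℂ) x} = GoldenWord.admissible n := by
  ext w
  simp only [GoldenWord.admissible, Finset.coe_filter, Finset.mem_univ, true_and,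
    Set.mem_ofPred_eq]
  constructor
  · rintro ⟨x, hx, rfl⟩
    have hx' := IsCycle.re hx hb hb'
    simp only [signWord, decide_eq_true_eq]
    exact ⟨fun k h ↦ hx'.not_neg_add_one hb hb' h.1 h.2, hx'.exists_not_neg hb hb'⟩
  · rintro ⟨h1, k₀, h2, h3⟩
    obtain ⟨x, hx, hxw⟩ := SignPattern.exists_isCycle (w := fun k ↦ w k = true) hb hb'
      (fun k hk hk' ↦ h1 k ⟨hk, hk'⟩) h2 h3
    refine ⟨fun k ↦ (x k : ℂ), hx.ofReal, ?_⟩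
    funext k
    rw [Bool.eq_iff_iff]
    simpa [signWord] using hxw k

end Orbit

theorem stmt10 (a : ℝ) (ha : a < 0) (ha' : a ≠ -1) (n : ℕ) (hn : 1 ≤ n) :
    Set.Finite {p : ℂ × ℂ | (∀ k < n, ((biratC (a : ℂ))^[k] p).1 ≠ 1) ∧
        (biratC (a : ℂ))^[n] p = p} ∧
    (∀ p ∈ {p : ℂ × ℂ | (∀ k < n, ((biratC (a : ℂ))^[k] p).1 ≠ 1) ∧
        (biratC (a : ℂ))^[n] p = p}, p.1.im = 0 ∧ p.2.im = 0) ∧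
    Set.ncard {p : ℂ × ℂ | (∀ k < n, ((biratC (a : ℂ))^[k] p).1 ≠ 1) ∧
        (biratC (a : ℂ))^[n] p = p} =
      (if Odd n then Nat.fib (n + 1) + Nat.fib (n - 1)
       else Nat.fib (n + 1) + Nat.fib (n - 1) - 2) := by
  have : NeZero n := ⟨by omega⟩
  have hb : 0 < -a := neg_pos.2 ha
  have hb' : -a ≠ 1 := fun h ↦ ha' (by linarith)
  have himage := image_signWord (n := n) hb hb'
  have hinj := injOn_signWord (n := n) hb hb'
  have hreal : ∀ x : ZMod n → ℂ, IsCycle ((-a : ℝ) : ℂ) x → ∀ k, (x k).im = 0 :=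
    fun x hx ↦ hx.im_eq_zero hb hb'
  rw [Complex.ofReal_neg] at himage hinj hreal
  have hfin : {x : ZMod n → ℂ | IsCycle (-a : ℂ) x}.Finite :=
    Set.Finite.of_finite_image (himage ▸ Finset.finite_toSet _) hinj
  rw [← image_isCycle_eq_periodic]
  refine ⟨hfin.image _, ?_, ?_⟩
  · rintro _ ⟨x, hx, rfl⟩
    simp [hreal x hx]
  · rw [injOn_isCycle.ncard_image, ← hinj.ncard_image, himage,
      Set.ncard_coe_finset, GoldenWord.card_admissible]
end

section
/- (All finite periodic points are saddles.) Let n ≥ 1 and let p ∈ ℝ² be such that the forward orbit of p is defined up to time n and fⁿ(p) = p. Then the derivative D(fⁿ)_p (a linear map ℝ² → ℝ²) satisfies det D(fⁿ)_p = 1 and |trace D(fⁿ)_p| > 2; equivalently, D(fⁿ)_p has two distinct real eigenvalues λ and 1/λ with |λ| > 1, so p is a periodic point of saddle type. -/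
open Filter

/-- A quantity that is monotone along orbits inside the first and the third quadrant. -/
def potential (a : ℝ) (q : ℝ × ℝ) : ℝ := q.2 * (q.1 + a)

/-- The open second and fourth quadrants. -/
def MixedQuadrant (q : ℝ × ℝ) : Prop := (0 < q.1 ∧ q.2 < 0) ∨ (q.1 < 0 ∧ 0 < q.2)

/-- The Jacobian matrix of `birat a`. -/
noncomputable def jacobian (a : ℝ) (q : ℝ × ℝ) : Matrix (Fin 2) (Fin 2) ℝ :=
  !![-(q.2 * (1 + a)) / (q.1 - 1) ^ 2, (q.1 + a) / (q.1 - 1); 1, 0]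

/-- The Jacobian matrix of the `n`-th iterate of `birat a`, as given by the chain rule. -/
noncomputable def jacobianIterate (a : ℝ) (p : ℝ × ℝ) : ℕ → Matrix (Fin 2) (Fin 2) ℝ
  | 0 => 1
  | k + 1 => jacobian a ((birat a)^[k] p) * jacobianIterate a p k

/-- The columns span the unstable cone at `q`: it is bounded by the direction `(x, ε y)` and by
the horizontal direction for `0 < x`, the vertical direction for `x ≤ 0`. -/
noncomputable def coneFrame (ε : ℝ) (q : ℝ × ℝ) : Matrix (Fin 2) (Fin 2) ℝ :=
  if 0 < q.1 then !![q.1, q.1; 0, ε * q.2] else !![0, q.1; ε * q.2, ε * q.2]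

/-- Up to a common sign, all entries are positive, except that the lower left one may vanish. -/
def ConePositive (N : Matrix (Fin 2) (Fin 2) ℝ) : Prop :=
  ∃ s : ℝ, 0 < s * N 0 0 ∧ 0 < s * N 0 1 ∧ 0 < s * N 1 1 ∧ 0 ≤ s * N 1 0

/-- The sign `ε` is opposite to that of `1 + a`. -/
def OppositeSign (a ε : ℝ) : Prop := (ε = 1 ∧ a < -1) ∨ (ε = -1 ∧ -1 < a)

theorem ConePositive.mul {N M : Matrix (Fin 2) (Fin 2) ℝ} (hN : ConePositive N)
    (hM : ConePositive M) : ConePositive (N * M) := by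
  obtain ⟨s, h1, h2, h3, h4⟩ := hN
  obtain ⟨t, k1, k2, k3, k4⟩ := hM
  refine ⟨s * t, ?_, ?_, ?_, ?_⟩ <;> rw [Matrix.mul_apply, Fin.sum_univ_two]
  · linarith [mul_pos h1 k1, mul_nonneg h2.le k4]
  · linarith [mul_pos h1 k2, mul_pos h2 k3]
  · linarith [mul_nonneg h4 k2.le, mul_pos h3 k3]
  · linarith [mul_nonneg h4 k1.le, mul_nonneg h3.le k4]

theorem ConePositive.mul_apply_ne_zero {N M : Matrix (Fin 2) (Fin 2) ℝ} (hN : ConePositive N)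
    (hM : ConePositive M) (h : N 1 0 ≠ 0 ∨ M 1 0 ≠ 0) : (N * M) 1 0 ≠ 0 := by
  obtain ⟨s, h1, -, h3, h4⟩ := hN
  obtain ⟨t, k1, -, k3, k4⟩ := hM
  have hs : s ≠ 0 := by rintro rfl; simp at h1
  have ht : t ≠ 0 := by rintro rfl; simp at k1
  rw [Matrix.mul_apply, Fin.sum_univ_two]
  intro h0
  have e : (s * N 1 0) * (t * M 0 0) + (s * N 1 1) * (t * M 1 0) = 0 := by
    linear_combination s * t * h0
  rcases h with h | h
  · have : 0 < s * N 1 0 := lt_of_le_of_ne h4 (mul_ne_zero hs h).symm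
    linarith [mul_pos this k1, mul_nonneg h3.le k4]
  · have : 0 < t * M 1 0 := lt_of_le_of_ne k4 (mul_ne_zero ht h).symm
    linarith [mul_pos h3 this, mul_nonneg h4 k1.le]

theorem ConePositive.two_lt_abs_trace {N : Matrix (Fin 2) (Fin 2) ℝ} (hN : ConePositive N)
    (h : N 1 0 ≠ 0) (hdet : N.det = 1) : 2 < |N.trace| := by
  obtain ⟨s, h1, h2, h3, h4⟩ := hN
  have hs : s ≠ 0 := by rintro rfl; simp at h1
  have h4' : 0 < s * N 1 0 := lt_of_le_of_ne h4 (mul_ne_zero hs h).symm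
  rw [Matrix.det_fin_two] at hdet
  rw [Matrix.trace_fin_two]
  have hs2 : 0 < s ^ 2 := by positivity
  have hbc : 0 < N 0 1 * N 1 0 := by
    have := mul_pos h2 h4'
    exact pos_of_mul_pos_right (by linarith : 0 < s ^ 2 * (N 0 1 * N 1 0)) hs2.le
  refine lt_of_pow_lt_pow_left₀ 2 (abs_nonneg _) ?_
  rw [sq_abs]
  nlinarith [sq_nonneg (N 0 0 - N 1 1)]

theorem mixedQuadrant_or (q : ℝ × ℝ) :
    MixedQuadrant q ∨ (0 ≤ q.1 ∧ 0 ≤ q.2) ∨ (q.1 ≤ 0 ∧ q.2 ≤ 0) := by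
  unfold MixedQuadrant
  rcases lt_trichotomy q.1 0 with h | h | h <;> rcases lt_trichotomy q.2 0 with k | k | k <;>
    simp [h, k, h.le, k.le]

theorem birat_fst_mul {a : ℝ} {q : ℝ × ℝ} (h : q.1 ≠ 1) :
    (birat a q).1 * (q.1 - 1) = q.2 * (q.1 + a) := by
  have : q.1 - 1 ≠ 0 := sub_ne_zero.2 h
  simp only [birat]
  field_simp

theorem potential_birat {a : ℝ} {q : ℝ × ℝ} (h : q.1 ≠ 1) :
    potential a (birat a q) = potential a q + a * ((birat a q).1 + (birat a q).2) := by
  have h1 := birat_fst_mul (a := a) h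
  have h2 : (birat a q).2 = q.1 + a - 1 := rfl
  unfold potential
  rw [h2]
  linear_combination h1

theorem third_quadrant_birat {a : ℝ} (ha : a < 0) {q : ℝ × ℝ} (hq : q.1 ≤ 0 ∧ q.2 ≤ 0) :
    (birat a q).1 ≤ 0 ∧ (birat a q).2 < 0 := by
  refine ⟨?_, by simp only [birat]; linarith⟩
  simp only [birat]
  exact div_nonpos_of_nonneg_of_nonpos
    (mul_nonneg_of_nonpos_of_nonpos hq.2 (by linarith)) (by linarith)

theorem first_quadrant_of_birat {a : ℝ} (ha : a < 0) {q : ℝ × ℝ} (h : q.1 ≠ 1)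
    (hq : 0 ≤ (birat a q).1 ∧ 0 ≤ (birat a q).2) : 0 < q.1 ∧ 0 ≤ q.2 := by
  have h1 := birat_fst_mul (a := a) h
  have h2 : (birat a q).2 = q.1 + a - 1 := rfl
  have h3 : 0 ≤ q.1 + a - 1 := h2 ▸ hq.2
  refine ⟨by linarith, ?_⟩
  have h4 : 0 ≤ q.2 * (q.1 + a) := h1 ▸ mul_nonneg hq.1 (by linarith)
  exact nonneg_of_mul_nonneg_left h4 (by linarith)

theorem mixedQuadrant_of_periodic {a : ℝ} (ha : a < 0) {n : ℕ} (hn : 1 ≤ n) {p : ℝ × ℝ}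
    (hdef : ∀ k, ((birat a)^[k] p).1 ≠ 1) (hper : (birat a)^[n] p = p) : MixedQuadrant p := by
  rcases mixedQuadrant_or p with h | h | h
  · exact h
  · exfalso
    have hback : ∀ j k, j + k = n → 0 ≤ ((birat a)^[k] p).1 ∧ 0 ≤ ((birat a)^[k] p).2 := by
      intro j
      induction j with
      | zero => intro k hk; rw [zero_add] at hk; rwa [hk, hper]
      | succ j ih =>
        intro k hk
        have := ih (k + 1) (by omega)
        rw [Function.iterate_succ_apply'] at this
        have := first_quadrant_of_birat ha (hdef k) this
        exact ⟨this.1.le, this.2⟩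
    have hpos : 0 < p.1 := by
      have := hback (n - 1) 1 (by omega)
      exact (first_quadrant_of_birat ha (hdef 0) this).1
    have hmono : ∀ k, k ≤ n → potential a ((birat a)^[k] p) ≤ potential a p := by
      intro k
      induction k with
      | zero => intro _; exact le_rfl
      | succ k ih =>
        intro hk
        have h1 := hback (n - (k + 1)) (k + 1) (by omega)
        have h2 := ih (by omega)
        rw [Function.iterate_succ_apply'] at h1 ⊢
        rw [potential_birat (hdef k)]
        nlinarith [mul_nonneg (neg_pos.2 ha).le (add_nonneg h1.1 h1.2)]
    obtain ⟨m, rfl⟩ : ∃ m, n = m + 1 := ⟨n - 1, by omega⟩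
    have h1 := hmono m (by omega)
    have h2 := potential_birat (a := a) (hdef m)
    rw [← Function.iterate_succ_apply' (birat a), hper] at h2
    nlinarith [mul_pos (neg_pos.2 ha) (add_pos_of_pos_of_nonneg hpos h.2)]
  · exfalso
    have hfwd : ∀ k, ((birat a)^[k] p).1 ≤ 0 ∧ ((birat a)^[k] p).2 ≤ 0 := by
      intro k
      induction k with
      | zero => exact h
      | succ k ih =>
        rw [Function.iterate_succ_apply']
        have := third_quadrant_birat ha ih
        exact ⟨this.1, this.2.le⟩
    have hmono : StrictMono fun k ↦ potential a ((birat a)^[k] p) := by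
      refine strictMono_nat_of_lt_succ fun k ↦ ?_
      rw [Function.iterate_succ_apply', potential_birat (hdef k)]
      have := third_quadrant_birat ha (hfwd k)
      nlinarith [mul_pos_of_neg_of_neg ha (add_neg_of_nonpos_of_neg this.1 this.2)]
    have := hmono (show 0 < n by omega)
    simp [hper] at this

theorem birat_snd_sub_fst {a : ℝ} {q : ℝ × ℝ} (h : q.1 ≠ 1) :
    (birat a q).2 - (birat a q).1 + 1 = (jacobian a q).det * (q.2 - q.1 + 1) := by
  have : q.1 - 1 ≠ 0 := sub_ne_zero.2 h
  simp only [birat, jacobian, Matrix.det_fin_two_of]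
  field_simp
  ring

theorem det_jacobianIterate_mul {a : ℝ} {p : ℝ × ℝ} (hdef : ∀ k, ((birat a)^[k] p).1 ≠ 1) (k : ℕ) :
    (jacobianIterate a p k).det * (p.2 - p.1 + 1) =
      ((birat a)^[k] p).2 - ((birat a)^[k] p).1 + 1 := by
  induction k with
  | zero => simp [jacobianIterate]
  | succ k ih =>
    rw [Function.iterate_succ_apply', birat_snd_sub_fst (hdef k), ← ih, jacobianIterate,
      Matrix.det_mul]
    ring

theorem snd_sub_fst_ne_zero_of_periodic {a : ℝ} (ha : a < 0) {n : ℕ} (hn : 1 ≤ n) {p : ℝ × ℝ}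
    (hdef : ∀ k, ((birat a)^[k] p).1 ≠ 1) (hper : (birat a)^[n] p = p) : p.2 - p.1 + 1 ≠ 0 := by
  intro h0
  have hline : ∀ k, ((birat a)^[k] p).2 = ((birat a)^[k] p).1 - 1 := by
    intro k
    have := det_jacobianIterate_mul hdef k
    rw [h0, mul_zero] at this
    linarith
  have hanti : StrictAnti fun k ↦ ((birat a)^[k] p).1 := by
    refine strictAnti_nat_of_succ_lt fun k ↦ ?_
    have h1 := hline (k + 1)
    rw [Function.iterate_succ_apply'] at h1 ⊢
    have h2 : (birat a ((birat a)^[k] p)).2 = ((birat a)^[k] p).1 + a - 1 := rfl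
    linarith
  have := hanti (show 0 < n by omega)
  simp [hper] at this

theorem hasFDerivAt_birat {a : ℝ} {q : ℝ × ℝ} (h : q.1 ≠ 1) :
    HasFDerivAt (birat a) (LinearMap.toContinuousLinearMap
      (Matrix.toLin (Module.Basis.finTwoProd ℝ) (Module.Basis.finTwoProd ℝ) (jacobian a q))) q := by
  have hq : q.1 - 1 ≠ 0 := sub_ne_zero.2 h
  have hx : HasFDerivAt (fun z : ℝ × ℝ ↦ z.1) (ContinuousLinearMap.fst ℝ ℝ ℝ) q := hasFDerivAt_fst
  have hy : HasFDerivAt (fun z : ℝ × ℝ ↦ z.2) (ContinuousLinearMap.snd ℝ ℝ ℝ) q := hasFDerivAt_snd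
  have h1 := (hy.mul (hx.add_const a)).mul ((hasDerivAt_inv hq).comp_hasFDerivAt q (hx.sub_const 1))
  have h2 := (hx.add_const a).sub_const 1
  refine (h1.prodMk h2).congr_fderiv ?_
  ext <;> simp [jacobian, Matrix.toLin_finTwoProd_apply] <;> field_simp
  ring

theorem hasFDerivAt_iterate_birat {a : ℝ} {p : ℝ × ℝ} (hdef : ∀ k, ((birat a)^[k] p).1 ≠ 1)
    (k : ℕ) : HasFDerivAt ((birat a)^[k]) (LinearMap.toContinuousLinearMap
      (Matrix.toLin (Module.Basis.finTwoProd ℝ) (Module.Basis.finTwoProd ℝ)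
        (jacobianIterate a p k))) p := by
  induction k with
  | zero =>
    refine (hasFDerivAt_id p).congr_fderiv ?_
    ext <;> simp [jacobianIterate]
  | succ k ih =>
    rw [Function.iterate_succ']
    refine ((hasFDerivAt_birat (hdef k)).comp p ih).congr_fderiv ?_
    rw [jacobianIterate, Matrix.toLin_mul _ (Module.Basis.finTwoProd ℝ)]
    rfl

theorem det_coneFrame_ne_zero {a ε : ℝ} (hε : OppositeSign a ε) {q : ℝ × ℝ}
    (hq : MixedQuadrant q) : (coneFrame ε q).det ≠ 0 := by
  have h0 : ε ≠ 0 := by rcases hε with h | h <;> simp [h.1]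
  have h1 : q.1 ≠ 0 := by rcases hq with h | h <;> [exact h.1.ne'; exact h.1.ne]
  have h2 : q.2 ≠ 0 := by rcases hq with h | h <;> [exact h.2.ne; exact h.2.ne']
  unfold coneFrame
  split_ifs <;> simp [Matrix.det_fin_two_of, h0, h1, h2]

theorem boundary_image_neg {a ε x : ℝ} (ha : a < 0) (hε : OppositeSign a ε) (h1 : x - 1 ≠ 0)
    (h2 : x + a ≠ 0) (h3 : x + a - 1 ≠ 0) :
    (ε * (-((1 + a) * x) / ((x + a) * (x - 1))) + 1 - x / (x + a - 1)) *
      ((x + a) * (x - 1) * (x + a - 1)) < 0 := by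
  rcases hε with ⟨rfl, h⟩ | ⟨rfl, h⟩
  · have : (1 * (-((1 + a) * x) / ((x + a) * (x - 1))) + 1 - x / (x + a - 1)) *
        ((x + a) * (x - 1) * (x + a - 1)) = -(2 * x ^ 2 + 2 * (a - 1) * x + a * (a - 1)) := by
      field_simp
      ring
    rw [this]
    nlinarith [sq_nonneg (2 * x + (a - 1)), mul_pos (sub_pos.2 h) (show 0 < 1 - a by linarith)]
  · have : (-1 * (-((1 + a) * x) / ((x + a) * (x - 1))) + 1 - x / (x + a - 1)) *
        ((x + a) * (x - 1) * (x + a - 1)) = a * (2 * x ^ 2 + 2 * (a - 1) * x - (a - 1)) := by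
      field_simp
      ring
    rw [this]
    refine mul_neg_of_neg_of_pos ha ?_
    nlinarith [sq_nonneg (2 * x + (a - 1)), mul_pos (sub_pos.2 h) (show 0 < 1 - a by linarith)]

theorem fst_birat_pos_of_neg {a : ℝ} (ha : a < 0) {q : ℝ × ℝ} (hq : q.1 < 0)
    (hq' : MixedQuadrant (birat a q)) : 0 < (birat a q).1 := by
  rcases hq' with h | h
  · exact h.1
  · have h2 : (birat a q).2 = q.1 + a - 1 := rfl
    linarith [h.2]

theorem exists_conePositive {a ε : ℝ} (ha : a < 0) (hε : OppositeSign a ε) {q : ℝ × ℝ}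
    (h : q.1 ≠ 1) (hq : MixedQuadrant q) (hq' : MixedQuadrant (birat a q)) :
    ∃ N, jacobian a q * coneFrame ε q = coneFrame ε (birat a q) * N ∧ ConePositive N ∧
      (0 < q.1 → N 1 0 ≠ 0) := by
  have hfst := birat_fst_mul (a := a) h
  have hpos := fun h : q.1 < 0 ↦ fst_birat_pos_of_neg ha h hq'
  obtain ⟨x, y⟩ := q
  have hx' : (birat a (x, y)).1 = y * (x + a) / (x - 1) := rfl
  have hy' : (birat a (x, y)).2 = x + a - 1 := rfl
  simp only [MixedQuadrant, hy'] at h hq hq' hfst hpos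
  have h1 : x - 1 ≠ 0 := sub_ne_zero.2 h
  have h2 : x + a ≠ 0 := by
    intro h0
    rw [h0, mul_zero] at hfst
    have := (mul_eq_zero.1 hfst).resolve_right h1
    rcases hq' with h | h <;> linarith [h.1]
  have h3 : x + a - 1 ≠ 0 := by rcases hq' with h | h <;> [exact h.2.ne; exact h.2.ne']
  have hK := boundary_image_neg ha hε h1 h2 h3
  have hεε : ε * ε = 1 := by rcases hε with h | h <;> simp [h.1]
  have hε0 : ε ≠ 0 := by rintro rfl; simp at hεε
  have hdε : ε * (x / (x + a - 1) / ε) = x / (x + a - 1) := mul_div_cancel₀ _ hε0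
  rcases hq with ⟨hx, hy⟩ | ⟨hx, hy⟩
  · rcases hq' with ⟨hX, hY⟩ | ⟨hX, hY⟩
    · have hprod : (x + a) * (x - 1) < 0 := by
        have : 0 < y * ((x + a) * (x - 1)) := by
          rw [← mul_assoc, ← hfst, mul_assoc]
          exact mul_pos hX (mul_self_pos.2 h1)
        exact neg_of_mul_pos_right this hy.le
      have hK' := neg_of_mul_neg_left hK (mul_pos_of_neg_of_neg hprod hY).le
      have hd : x / (x + a - 1) < 0 := div_neg_of_pos_of_neg hx hY
      refine ⟨!![-((1 + a) * x) / ((x + a) * (x - 1)) - x / (x + a - 1) / ε,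
          -((1 + a) * x) / ((x + a) * (x - 1)) + ε - x / (x + a - 1) / ε;
          x / (x + a - 1) / ε, x / (x + a - 1) / ε], ?_, ⟨-ε, ?_⟩, ?_⟩
      · rw [coneFrame, coneFrame, if_pos hx, if_pos hX, hx', hy']
        ext i j
        fin_cases i <;> fin_cases j <;> simp [jacobian] <;> field_simp <;> ring
      · simp
        refine ⟨?_, ?_, ?_, ?_⟩ <;> nlinarith
      · intro _
        simpa [hε0] using hd.ne
    · have hy0 : 0 < (x + a) * (x - 1) := mul_pos (by linarith) (by linarith)
      have hK' := neg_of_mul_neg_left hK (mul_pos hy0 hY).le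
      have hc : 0 < ε * (-((1 + a) * x) / ((x + a) * (x - 1))) := by
        rw [mul_div_assoc']
        refine div_pos ?_ hy0
        rcases hε with ⟨rfl, h⟩ | ⟨rfl, h⟩ <;> nlinarith
      refine ⟨!![x / (x + a - 1) / ε - -((1 + a) * x) / ((x + a) * (x - 1)),
          x / (x + a - 1) / ε - -((1 + a) * x) / ((x + a) * (x - 1)) - ε;
          -((1 + a) * x) / ((x + a) * (x - 1)),
          -((1 + a) * x) / ((x + a) * (x - 1)) + ε], ?_, ⟨ε, ?_⟩, ?_⟩
      · rw [coneFrame, coneFrame, if_pos hx, if_neg hX.not_gt, hx', hy']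
        ext i j
        fin_cases i <;> fin_cases j <;> simp [jacobian] <;> field_simp <;> ring
      · simp
        refine ⟨?_, ?_, ?_, ?_⟩ <;> nlinarith
      · intro _
        exact (right_ne_zero_of_mul hc.ne')
  · have hX := hpos hx
    have hprod : 0 < (x + a) * (x - 1) := mul_pos_of_neg_of_neg (by linarith) (by linarith)
    have hY : x + a - 1 < 0 := by linarith
    have hK' := pos_of_mul_neg_left hK (mul_neg_of_pos_of_neg hprod hY).le
    have hd : 0 < x / (x + a - 1) := div_pos_of_neg_of_neg hx hY
    refine ⟨!![ε, -((1 + a) * x) / ((x + a) * (x - 1)) + ε - x / (x + a - 1) / ε;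
        0, x / (x + a - 1) / ε], ?_, ⟨ε, ?_⟩, fun h ↦ absurd h hx.not_gt⟩
    · rw [coneFrame, coneFrame, if_neg hx.not_gt, if_pos hX, hx', hy']
      ext i j
      fin_cases i <;> fin_cases j <;> simp [jacobian] <;> field_simp
      ring
    · simp
      refine ⟨?_, ?_, ?_⟩ <;> nlinarith

theorem exists_conePositive_iterate {a ε : ℝ} (ha : a < 0) (hε : OppositeSign a ε) {p : ℝ × ℝ}
    (hdef : ∀ k, ((birat a)^[k] p).1 ≠ 1) (hq : ∀ k, MixedQuadrant ((birat a)^[k] p)) (k : ℕ) :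
    ∃ N, jacobianIterate a p (k + 1) * coneFrame ε p = coneFrame ε ((birat a)^[k + 1] p) * N ∧
      ConePositive N ∧ (N 1 0 ≠ 0 ∨ ∀ j ≤ k, ((birat a)^[j] p).1 < 0) := by
  have hstep : ∀ k, ∃ N, jacobian a ((birat a)^[k] p) * coneFrame ε ((birat a)^[k] p) =
      coneFrame ε ((birat a)^[k + 1] p) * N ∧ ConePositive N ∧
      (0 < ((birat a)^[k] p).1 → N 1 0 ≠ 0) := by
    intro k
    have := hq (k + 1)
    rw [Function.iterate_succ_apply'] at this ⊢
    exact exists_conePositive ha hε (hdef k) (hq k) this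
  induction k with
  | zero =>
    obtain ⟨N, h1, h2, h3⟩ := hstep 0
    refine ⟨N, by simpa [jacobianIterate] using h1, h2, ?_⟩
    rcases hq 0 with h | h
    · exact Or.inl (h3 h.1)
    · exact Or.inr fun j hj ↦ by rw [Nat.le_zero.1 hj]; exact h.1
  | succ k ih =>
    obtain ⟨M, k1, k2, k3⟩ := ih
    obtain ⟨N, h1, h2, h3⟩ := hstep (k + 1)
    refine ⟨N * M, ?_, h2.mul k2, ?_⟩
    · rw [jacobianIterate, Matrix.mul_assoc, k1, ← Matrix.mul_assoc, h1, Matrix.mul_assoc]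
    · rcases k3 with k3 | k3
      · exact Or.inl (h2.mul_apply_ne_zero k2 (Or.inr k3))
      · rcases hq (k + 1) with h | h
        · exact Or.inl (h2.mul_apply_ne_zero k2 (Or.inl (h3 h.1)))
        · refine Or.inr fun j hj ↦ ?_
          rcases Nat.le_succ_iff.1 hj with hj | rfl
          exacts [k3 j hj, h.1]

theorem iterate_birat_fst_ne_one {a : ℝ} {n : ℕ} (hn : 1 ≤ n) {p : ℝ × ℝ}
    (hdef : orbitDefined a p n) (hper : (birat a)^[n] p = p) (k : ℕ) :
    ((birat a)^[k] p).1 ≠ 1 := by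
  rw [← Function.IsPeriodicPt.iterate_mod_apply hper k]
  exact hdef _ (Nat.mod_lt _ hn)

theorem stmt11 (a : ℝ) (ha : a < 0) (ha' : a ≠ -1) (n : ℕ) (hn : 1 ≤ n) (p : ℝ × ℝ)
    (hdef : orbitDefined a p n) (hper : (birat a)^[n] p = p) :
    LinearMap.det (fderiv ℝ ((birat a)^[n]) p).toLinearMap = 1 ∧
    2 < |LinearMap.trace ℝ (ℝ × ℝ) (fderiv ℝ ((birat a)^[n]) p).toLinearMap| := by
  have hdef' := iterate_birat_fst_ne_one hn hdef hper
  have hq : ∀ k, MixedQuadrant ((birat a)^[k] p) := by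
    intro k
    refine mixedQuadrant_of_periodic ha hn (fun j ↦ ?_) (Function.IsPeriodicPt.apply_iterate hper k)
    rw [← Function.iterate_add_apply]
    exact hdef' _
  have hdet : (jacobianIterate a p n).det = 1 := by
    have h1 := det_jacobianIterate_mul hdef' n
    rw [hper] at h1
    exact mul_right_cancel₀ (snd_sub_fst_ne_zero_of_periodic ha hn hdef' hper)
      (h1.trans (one_mul _).symm)
  rw [(hasFDerivAt_iterate_birat hdef' n).fderiv]
  refine ⟨by simpa [LinearMap.det_toLin] using hdet, ?_⟩
  have htrace : 2 < |(jacobianIterate a p n).trace| := by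
    obtain ⟨ε, hε⟩ : ∃ ε, OppositeSign a ε := by
      rcases lt_or_gt_of_ne ha' with h | h
      · exact ⟨1, Or.inl ⟨rfl, h⟩⟩
      · exact ⟨-1, Or.inr ⟨rfl, h⟩⟩
    have hT : IsUnit (coneFrame ε p).det :=
      isUnit_iff_ne_zero.2 (det_coneFrame_ne_zero hε (hq 0))
    obtain ⟨m, rfl⟩ : ∃ m, n = m + 1 := ⟨n - 1, by omega⟩
    obtain ⟨N, h1, h2, h3⟩ := exists_conePositive_iterate ha hε hdef' hq m
    rw [hper] at h1
    have hN : N = (coneFrame ε p)⁻¹ * (jacobianIterate a p (m + 1) * coneFrame ε p) := by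
      rw [h1, Matrix.nonsing_inv_mul_cancel_left _ _ hT]
    have htr : N.trace = (jacobianIterate a p (m + 1)).trace := by
      rw [hN, Matrix.trace_mul_comm, Matrix.mul_nonsing_inv_cancel_right _ _ hT]
    have hNdet : N.det = 1 := by
      have := congrArg Matrix.det h1
      rw [Matrix.det_mul, Matrix.det_mul, hdet, one_mul] at this
      exact mul_left_cancel₀ hT.ne_zero (this.symm.trans (mul_one _).symm)
    rw [← htr]
    refine h2.two_lt_abs_trace (h3.resolve_right fun h ↦ ?_) hNdet
    have hlast := hq (m + 1)
    rw [Function.iterate_succ_apply'] at hlast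
    have hpos := fst_birat_pos_of_neg ha (h m le_rfl) hlast
    rw [← Function.iterate_succ_apply' (birat a), hper] at hpos
    exact lt_asymm hpos (h 0 (Nat.zero_le _))
  simpa using htrace
end
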